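/- arXiv:2205.12829 — 7 statements merged into one kernel-verified Lean document; each statement's English description precedes it below -/
import Mathlib

section
/- Let A, B, C, D be integers with C ≥ 1 and D ≥ 1, and let Φ = Φ_{A,B,C,D}. Then there exist positive integers m and n with m·n dividing C·D², and an invertible 2×2 matrix g with rational entries, such that for all distinct irrational real numbers ξ and ξ', setting (S,T) = g·(ξ,1), (S',T') = g·(ξ',1), Ξ = (D·S², D·S·T, A·S² + B·S·T + C·T²) and Ξ' = (D·S'², D·S'·T', A·S'² + B·S'·T' + C·T'²), the following two identities hold: (i) for every Σ ∈ ℝ³ with ⟨Σ,Ξ⟩_Φ = 0 and Σ not a real scalar multiple of Ξ, λ_Φ(Ξ;Σ) = m · limsup_{q ∈ ℚ, q → ξ} gcd(den(q), n)/(den(q)² · |q − ξ|); (ii) for every nonzero Σ ∈ ℝ³ with ⟨Σ,Ξ⟩_Φ = ⟨Σ,Ξ'⟩_Φ = 0, μ_Φ(Σ) = m · sup_{(s,t) ∈ ℤ²∖{(0,0)}} |ξ − ξ'| · gcd(t, n) / |(s − t·ξ)(s − t·ξ')| (with gcd(0,n) = n). -/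
noncomputable section
open Filter Topology
open scoped ENNReal LinearAlgebra.Projectivization

abbrev V3 := Fin 3 → ℝ

instance : TopologicalSpace (ℙ ℝ V3) :=
  TopologicalSpace.coinduced (Projectivization.mk' ℝ) inferInstance

/-- The ternary quadratic form `A X² + B XY + C Y² + D XZ + E YZ + F Z²` on `ℝ³`. -/
def Phi6 (A B C D E F : ℤ) (P : V3) : ℝ :=
  A * P 0 ^ 2 + B * P 0 * P 1 + C * P 1 ^ 2 + D * P 0 * P 2 + E * P 1 * P 2 + F * P 2 ^ 2

/-- The discriminant: four times the determinant of the Gram matrix. -/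
def disc6 (A B C D E F : ℤ) : ℤ :=
  4 * A * C * F + B * D * E - A * E ^ 2 - C * D ^ 2 - F * B ^ 2

/-- The bilinear form associated to a quadratic form. -/
def bil (Φ : V3 → ℝ) (P Q : V3) : ℝ := (Φ (P + Q) - Φ P - Φ Q) / 2

def intCast3 (P : Fin 3 → ℤ) : V3 := fun i => (P i : ℝ)

/-- Nonzero integer points on the conic `Φ = 0`. -/
def ConicPts (Φ : V3 → ℝ) := {P : Fin 3 → ℤ // intCast3 P ≠ 0 ∧ Φ (intCast3 P) = 0}

/-- Lagrange approximability `λ_Φ(Ξ; Σ)`: limsup of `√(Δ·|Φ(Σ)|)/|⟨Σ,P⟩|` over nonzero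
integer zeros `P` of `Φ`, along the pullback of the neighborhood filter of `[Ξ]` in `ℙ²(ℝ)`. -/
def lambdaPhi (Φ : V3 → ℝ) (Δ : ℝ) (Ξ Sg : V3) : ℝ≥0∞ :=
  if hΞ : Ξ ≠ 0 then
    Filter.limsup
      (fun P : ConicPts Φ =>
        ENNReal.ofReal (Real.sqrt (Δ * |Φ Sg|) / |bil Φ Sg (intCast3 P.1)|))
      (Filter.comap (fun P : ConicPts Φ => Projectivization.mk ℝ (intCast3 P.1) P.2.1)
        (nhds (Projectivization.mk ℝ Ξ hΞ)))
  else 0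

/-- Markoff approximability `μ_Φ(Σ)`. -/
def muPhi (Φ : V3 → ℝ) (Δ : ℝ) (Sg : V3) : ℝ≥0∞ :=
  ⨆ (P : Fin 3 → ℤ) (_ : intCast3 P ≠ 0) (_ : Φ (intCast3 P) = 0)
    (_ : bil Φ Sg (intCast3 P) ≠ 0),
    ENNReal.ofReal (Real.sqrt (Δ * |Φ Sg|) / |bil Φ Sg (intCast3 P)|)

/-- `Ξ` spans an irrational line: no nonzero integer vector is proportional to `Ξ`. -/
def IrrationalLine (Ξ : V3) : Prop :=
  ∀ P : Fin 3 → ℤ, P ≠ 0 → ∀ c : ℝ, intCast3 P ≠ c • Ξ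

/-- Classical approximability of a real number. -/
def lambdaCl (ξ : ℝ) : ℝ≥0∞ :=
  Filter.limsup (fun q : ℚ => ENNReal.ofReal (1 / ((q.den : ℝ) ^ 2 * |(q : ℝ) - ξ|)))
    (Filter.comap (fun q : ℚ => (q : ℝ)) (nhds ξ))

/-- Classical Markoff approximability of a pair of real numbers. -/
def muCl (η η' : ℝ) : ℝ≥0∞ :=
  ⨆ (st : ℤ × ℤ) (_ : st ≠ 0),
    ENNReal.ofReal (|η - η'| / |((st.1 : ℝ) - st.2 * η) * ((st.1 : ℝ) - st.2 * η')|)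

/-- The `n`-Lagrange approximability. -/
def nLagrange (n : ℕ) (ξ : ℝ) : ℝ≥0∞ :=
  Filter.limsup
    (fun q : ℚ => ENNReal.ofReal ((Nat.gcd q.den n : ℝ) / ((q.den : ℝ) ^ 2 * |(q : ℝ) - ξ|)))
    (Filter.comap (fun q : ℚ => (q : ℝ)) (nhds ξ))

/-- The `n`-Markoff approximability. -/
def nMarkoff (n : ℕ) (ξ ξ' : ℝ) : ℝ≥0∞ :=
  ⨆ (st : ℤ × ℤ) (_ : st ≠ 0),
    ENNReal.ofReal (|ξ - ξ'| * (Int.gcd st.2 (n : ℤ) : ℝ) /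
      |((st.1 : ℝ) - st.2 * ξ) * ((st.1 : ℝ) - st.2 * ξ')|)

/-- The quaternion ring `R_{A,B,C,D}` as a `ℤ`-submodule of `Mat₂(ℤ)`. -/
def Rring (A B C D : ℤ) : Submodule ℤ (Matrix (Fin 2) (Fin 2) ℤ) :=
  Submodule.span ℤ {1, !![B, C; -A, 0], !![0, 0; 0, D], !![0, 0; D, 0]}

/-- The real point of the conic `Φ_{A,B,C,D} = 0` with parameter `ξ`. -/
def XiOf (A B C D : ℤ) (ξ : ℝ) : V3 :=
  ![(D : ℝ) * ξ ^ 2, (D : ℝ) * ξ, (A : ℝ) * ξ ^ 2 + (B : ℝ) * ξ + (C : ℝ)]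


theorem gcd_prime_pow_eq {p : ℕ} (hp : p.Prime) (i : ℕ) {z : ℤ} (hz : z ≠ 0) :
    Int.gcd ((p : ℤ) ^ i) z = p ^ min i (padicValInt p z) := by
  have h1 : Int.gcd ((p : ℤ) ^ i) z = Nat.gcd (p ^ i) z.natAbs := by
    rw [Int.gcd, Int.natAbs_pow, Int.natAbs_natCast]
  rw [h1, padicValInt]
  have hz' : z.natAbs ≠ 0 := by simpa using hz
  obtain ⟨j, hj, hj'⟩ := (Nat.dvd_prime_pow hp).1 (Nat.gcd_dvd_left (p ^ i) z.natAbs)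
  have := Fact.mk hp
  rw [hj']
  congr 1
  apply le_antisymm
  · refine le_min hj ?_
    rw [← padicValNat_dvd_iff_le hz', ← hj']
    exact Nat.gcd_dvd_right _ _
  · rw [← Nat.pow_dvd_pow_iff_le_right hp.one_lt, ← hj']
    refine Nat.dvd_gcd (pow_dvd_pow _ (min_le_left _ _)) ?_
    rw [padicValNat_dvd_iff_le hz']
    exact min_le_right _ _

/-- In `x + b = y` the smallest `p`-adic valuation is attained at least twice. -/
theorem padicValInt_add_cases {p : ℕ} (hp : p.Prime) {u b : ℤ} (hu : u ≠ 0) (hb : b ≠ 0)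
    (hub : u + b ≠ 0) :
    min (padicValInt p u) (padicValInt p b) ≤ padicValInt p (u + b) ∧
      min (padicValInt p (u + b)) (padicValInt p b) ≤ padicValInt p u ∧
      min (padicValInt p u) (padicValInt p (u + b)) ≤ padicValInt p b := by
  have := Fact.mk hp
  have key : ∀ {z : ℤ} (_ : z ≠ 0) (j : ℕ), (p : ℤ) ^ j ∣ z ↔ j ≤ padicValInt p z := by
    intro z hz j
    rw [padicValInt_dvd_iff]; simp [hz]
  refine ⟨?_, ?_, ?_⟩
  · rw [← key hub]
    exact dvd_add ((key hu _).2 (min_le_left _ _)) ((key hb _).2 (min_le_right _ _))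
  · rw [← key hu]
    have := dvd_sub ((key hub _).2 (min_le_left _ (padicValInt p b)))
      ((key hb _).2 (min_le_right _ _))
    simpa using this
  · rw [← key hb]
    have := dvd_sub ((key hub _).2 (min_le_right (padicValInt p u) _))
      ((key hu _).2 (min_le_left _ _))
    simpa using this

theorem Int.gcd_congr_of_dvd_sub {N x y : ℤ} (h : N ∣ x - y) : Int.gcd N x = Int.gcd N y := by
  obtain ⟨c, hc⟩ := h
  obtain rfl : x = y + N * c := by linarith
  simp

theorem Int.gcd_gcd_congr {N x y x' y' : ℤ} (hx : N ∣ x - x') (hy : N ∣ y - y') :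
    Int.gcd N (Int.gcd x y) = Int.gcd N (Int.gcd x' y') := by
  have : ∀ {x y x' y' : ℤ}, N ∣ x - x' → N ∣ y - y' →
      Int.gcd N (Int.gcd x y) ∣ Int.gcd N (Int.gcd x' y') := by
    intro x y x' y' hx hy
    have h1 : ((Int.gcd N (Int.gcd x y) : ℕ) : ℤ) ∣ N := Int.gcd_dvd_left ..
    have h2 : ((Int.gcd N (Int.gcd x y) : ℕ) : ℤ) ∣ (Int.gcd x y : ℤ) := Int.gcd_dvd_right ..
    refine Int.natCast_dvd_natCast.1 (Int.dvd_coe_gcd h1 (Int.dvd_coe_gcd ?_ ?_))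
    · exact (dvd_sub_right (h2.trans (Int.gcd_dvd_left ..))).1 (h1.trans hx)
    · exact (dvd_sub_right (h2.trans (Int.gcd_dvd_right ..))).1 (h1.trans hy)
  exact Nat.dvd_antisymm (this hx hy) (this ((dvd_sub_comm).1 hx) ((dvd_sub_comm).1 hy))

/-- The truncated valuation of `u * gcd(D, u + b)` is a sum of two truncated valuations. -/
theorem exists_local_factor {p : ℕ} (hp : p.Prime) (κ : ℕ) {D : ℕ} (hD : D ≠ 0) (b : ℤ) :
    ∃ α δ β : ℕ, ∃ y : ℤ, α ≤ κ ∧ δ ≤ κ ∧ β ≤ α ∧ β ≤ δ ∧ (p : ℤ) ^ β ∣ y ∧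
      p ^ (α + δ) ∣ p ^ β * (p ^ κ * D) ∧
      ∀ u : ℤ, Int.gcd ((p : ℤ) ^ κ) (Int.gcd (D * u) (u * (u + b))) =
        Int.gcd ((p : ℤ) ^ α) u * Int.gcd ((p : ℤ) ^ δ) (u + y) := by
  have := Fact.mk hp
  have hppos : (0 : ℤ) < (p : ℤ) ^ κ := by have := hp.pos; positivity
  -- replace `b` by a nonzero residue
  obtain ⟨b', hb', hbb⟩ : ∃ b' : ℤ, b' ≠ 0 ∧ (p : ℤ) ^ κ ∣ b - b' := by
    by_cases h : b = 0
    · exact ⟨(p : ℤ) ^ κ, hppos.ne', by simp [h]⟩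
    · exact ⟨b, h, by simp⟩
  set β := padicValInt p b' with hβ
  set d := padicValNat p D with hd
  have hpD : p ^ d ∣ D := pow_padicValNat_dvd
  have hpb : (p : ℤ) ^ β ∣ b' := padicValInt_dvd b'
  have hDi : (D : ℤ) ≠ 0 := by exact_mod_cast hD
  -- it suffices to treat `u` with `u ≠ 0` and `u + b' ≠ 0`
  suffices H : ∃ α δ β : ℕ, ∃ y : ℤ, α ≤ κ ∧ δ ≤ κ ∧ β ≤ α ∧ β ≤ δ ∧ (p : ℤ) ^ β ∣ y ∧
      α + δ ≤ β + κ + d ∧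
      ∀ u : ℤ, u ≠ 0 → u + b' ≠ 0 →
        p ^ min κ (min (d + padicValInt p u) (padicValInt p u + padicValInt p (u + b'))) =
        Int.gcd ((p : ℤ) ^ α) u * Int.gcd ((p : ℤ) ^ δ) (u + y) by
    obtain ⟨α, δ, β, y, h1, h2, h3, h4, h5, h6, h7⟩ := H
    refine ⟨α, δ, β, y, h1, h2, h3, h4, h5, ?_, fun u => ?_⟩
    · calc p ^ (α + δ) ∣ p ^ (β + κ + d) := pow_dvd_pow _ h6
        _ = p ^ β * (p ^ κ * p ^ d) := by ring
        _ ∣ _ := mul_dvd_mul_left _ (mul_dvd_mul_left _ hpD)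
    obtain ⟨u', hu', hub', huu⟩ : ∃ u' : ℤ, u' ≠ 0 ∧ u' + b' ≠ 0 ∧ (p : ℤ) ^ κ ∣ u - u' := by
      by_contra hcon
      push Not at hcon
      have e0 := hcon u
      have e1 := hcon (u + (p : ℤ) ^ κ)
      have e2 := hcon (u + 2 * (p : ℤ) ^ κ)
      have f0 : (p : ℤ) ^ κ ∣ u - u := by simp
      have f1 : (p : ℤ) ^ κ ∣ u - (u + (p : ℤ) ^ κ) := ⟨-1, by ring⟩
      have f2 : (p : ℤ) ^ κ ∣ u - (u + 2 * (p : ℤ) ^ κ) := ⟨-2, by ring⟩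
      generalize (p : ℤ) ^ κ = M at *
      grind
    rw [Int.gcd_gcd_congr (x' := D * u') (y' := u' * (u' + b'))
      (by rw [← mul_sub]; exact Dvd.dvd.mul_left huu _)
      (by
        have : u * (u + b) - u' * (u' + b') = (u - u') * (u + u' + b') + u * (b - b') := by ring
        rw [this]; exact dvd_add (Dvd.dvd.mul_right huu _) (Dvd.dvd.mul_left hbb _)),
      Int.gcd_congr_of_dvd_sub (N := (p : ℤ) ^ α) (y := u') ((pow_dvd_pow _ h1).trans huu),
      Int.gcd_congr_of_dvd_sub (N := (p : ℤ) ^ δ) (y := u' + y)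
        (by simpa using (pow_dvd_pow _ h2).trans huu), ← h7 u' hu' hub',
      ← Int.gcd_assoc, gcd_prime_pow_eq hp _ (mul_ne_zero hDi hu'), Nat.cast_pow,
      gcd_prime_pow_eq hp _ (mul_ne_zero hu' hub'),
      padicValInt.mul hDi hu', padicValInt.mul hu' hub', padicValInt.of_nat, min_assoc]
  by_cases c1 : κ ≤ 2 * β ∧ κ ≤ 2 * d
  · refine ⟨κ - κ / 2, κ / 2, κ / 2, 0, by omega, by omega, by omega, by omega, by simp,
      by omega, fun u hu hub => ?_⟩
    obtain ⟨h1, h2, h3⟩ := padicValInt_add_cases hp hu hb' hub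
    rw [add_zero, gcd_prime_pow_eq hp _ hu, gcd_prime_pow_eq hp _ hu, ← pow_add]
    congr 1
    omega
  by_cases c2 : d ≤ β
  · refine ⟨κ - d, d, d, 0, by omega, by omega, by omega, by omega, by simp,
      by omega, fun u hu hub => ?_⟩
    obtain ⟨h1, h2, h3⟩ := padicValInt_add_cases hp hu hb' hub
    rw [add_zero, gcd_prime_pow_eq hp _ hu, gcd_prime_pow_eq hp _ hu, ← pow_add]
    congr 1
    omega
  · refine ⟨κ - β, min (κ - β) d, β, b', by omega, by omega, by omega, by omega, hpb,
      by omega, fun u hu hub => ?_⟩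
    obtain ⟨h1, h2, h3⟩ := padicValInt_add_cases hp hu hb' hub
    rw [gcd_prime_pow_eq hp _ hu, gcd_prime_pow_eq hp _ hub, ← pow_add]
    congr 1
    omega

/-- The content `gcd(N, D s t, t² + B s t + F s²)` at coprime `(s, t)` is the product of the
contents of `(s, t)` with respect to two lattices. -/
def HasLatticePair (D : ℕ) (B F : ℤ) (N : ℕ) : Prop :=
  ∃ a e d : ℕ, ∃ x₁ x₂ : ℤ, 0 < d ∧ a ∣ N ∧ e ∣ N ∧ d ∣ a ∧ d ∣ e ∧ (d : ℤ) ∣ x₁ - x₂ ∧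
    a * e ∣ d * (N * D) ∧ ∀ s t : ℤ, IsCoprime s t →
      Int.gcd N (Int.gcd (D * (s * t)) (t ^ 2 + B * s * t + F * s ^ 2)) =
        Int.gcd a (t - x₁ * s) * Int.gcd e (t - x₂ * s)

theorem exists_factor_prime_pow {p : ℕ} (hp : p.Prime) (k : ℕ) {D : ℕ} (hD : D ≠ 0) (B F : ℤ) :
    ∃ α δ β : ℕ, ∃ x₁ x₂ : ℤ, α ≤ k ∧ δ ≤ k ∧ β ≤ α ∧ β ≤ δ ∧ (p : ℤ) ^ β ∣ x₁ - x₂ ∧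
      p ^ (α + δ) ∣ p ^ β * (p ^ k * D) ∧
      ∀ x : ℤ, Int.gcd ((p : ℤ) ^ k) (Int.gcd (D * x) (x ^ 2 + B * x + F)) =
        Int.gcd ((p : ℤ) ^ α) (x - x₁) * Int.gcd ((p : ℤ) ^ δ) (x - x₂) := by
  set φ : ℤ → ℕ := fun x => Int.gcd ((p : ℤ) ^ k) (Int.gcd (D * x) (x ^ 2 + B * x + F)) with hφ
  have hdvd : ∀ x, φ x ∣ p ^ k := fun x => by
    have : ((φ x : ℕ) : ℤ) ∣ ((p ^ k : ℕ) : ℤ) := by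
      rw [Nat.cast_pow]; exact Int.gcd_dvd_left ..
    exact Int.natCast_dvd_natCast.1 this
  -- a point where the content is maximal
  obtain ⟨x₀, hx₀⟩ : ∃ x₀, ∀ x, φ x ≤ φ x₀ := by
    have hbdd : BddAbove (Set.range φ) :=
      ⟨p ^ k, by rintro _ ⟨x, rfl⟩; exact Nat.le_of_dvd (pow_pos hp.pos _) (hdvd x)⟩
    obtain ⟨x₀, h⟩ := Nat.sSup_mem (Set.range_nonempty φ) hbdd
    exact ⟨x₀, fun x => h ▸ le_csSup hbdd ⟨x, rfl⟩⟩
  obtain ⟨κ, hκ, hκ'⟩ := (Nat.dvd_prime_pow hp).1 (hdvd x₀)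
  have hmax : ∀ x, φ x ∣ p ^ κ := fun x => by
    obtain ⟨j, hj, hj'⟩ := (Nat.dvd_prime_pow hp).1 (hdvd x)
    rw [hj']
    refine pow_dvd_pow _ ?_
    have := hx₀ x
    rwa [hj', hκ', Nat.pow_le_pow_iff_right hp.one_lt] at this
  have hg : ((p : ℤ) ^ κ) ∣ Int.gcd (D * x₀) (x₀ ^ 2 + B * x₀ + F) := by
    have : ((φ x₀ : ℕ) : ℤ) ∣ Int.gcd (D * x₀) (x₀ ^ 2 + B * x₀ + F) := Int.gcd_dvd_right ..
    rwa [hκ', Nat.cast_pow] at this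
  have hg1 : ((p : ℤ) ^ κ) ∣ D * x₀ := hg.trans (Int.gcd_dvd_left ..)
  have hg2 : ((p : ℤ) ^ κ) ∣ x₀ ^ 2 + B * x₀ + F := hg.trans (Int.gcd_dvd_right ..)
  obtain ⟨α, δ, β, y, h1, h2, h3, h4, h5, h6, h7⟩ :=
    exists_local_factor hp κ hD (2 * x₀ + B)
  refine ⟨α, δ, β, x₀, x₀ - y, h1.trans hκ, h2.trans hκ, h3, h4, by simpa using h5, ?_, fun x => ?_⟩
  · exact h6.trans (mul_dvd_mul_left _ (mul_dvd_mul_right (pow_dvd_pow _ hκ) _))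
  · have e1 : φ x = Int.gcd ((p : ℤ) ^ κ) (Int.gcd (D * x) (x ^ 2 + B * x + F)) := by
      apply Nat.dvd_antisymm
      · refine Int.natCast_dvd_natCast.1 (Int.dvd_coe_gcd ?_ (Int.gcd_dvd_right ..))
        have := Int.natCast_dvd_natCast.2 (hmax x)
        rwa [Nat.cast_pow] at this
      · refine Int.natCast_dvd_natCast.1 (Int.dvd_coe_gcd ?_ (Int.gcd_dvd_right ..))
        exact (Int.gcd_dvd_left ..).trans (pow_dvd_pow _ hκ)
    have e2 := h7 (x - x₀)
    rw [show x - x₀ + y = x - (x₀ - y) by ring] at e2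
    rw [← e2]
    change φ x = _
    rw [e1]
    refine Int.gcd_gcd_congr ?_ ?_
    · convert hg1 using 1; ring
    · convert hg2 using 1; ring

theorem Int.gcd_mul_right_of_isCoprime {N x s : ℤ} (h : IsCoprime N s) :
    Int.gcd N (s * x) = Int.gcd N x := by
  have h' : Int.gcd N s = 1 := Int.isCoprime_iff_gcd_eq_one.1 h
  rw [mul_comm]
  exact Int.gcd_mul_left_right_of_gcd_eq_one h'

theorem hasLatticePair_prime_pow {p : ℕ} (hp : p.Prime) (k : ℕ) {D : ℕ} (hD : D ≠ 0) (B F : ℤ) :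
    HasLatticePair D B F (p ^ k) := by
  obtain ⟨α, δ, β, x₁, x₂, h1, h2, h3, h4, h5, h6, h7⟩ := exists_factor_prime_pow hp k hD B F
  refine ⟨p ^ α, p ^ δ, p ^ β, x₁, x₂, pow_pos hp.pos _, pow_dvd_pow _ h1, pow_dvd_pow _ h2,
    pow_dvd_pow _ h3, pow_dvd_pow _ h4, by exact_mod_cast h5, by rwa [← pow_add], ?_⟩
  intro s t hst
  simp only [Nat.cast_pow]
  have hpI : Prime (p : ℤ) := Nat.prime_iff_prime_int.1 hp
  by_cases hps : (p : ℤ) ∣ s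
  · have hpt : IsCoprime (p : ℤ) t := hst.of_isCoprime_of_dvd_left hps
    obtain ⟨r, rfl⟩ := hps
    have one : ∀ (j : ℕ) (z : ℤ), IsCoprime (p : ℤ) z → Int.gcd ((p : ℤ) ^ j) z = 1 :=
      fun j z hz => Int.isCoprime_iff_gcd_eq_one.1 hz.pow_left
    have hQ : IsCoprime (p : ℤ) (t ^ 2 + B * (p * r) * t + F * (p * r) ^ 2) := by
      have : t ^ 2 + B * (p * r) * t + F * (p * r) ^ 2 =
          t ^ 2 + p * (B * r * t + F * p * r ^ 2) := by ring
      rw [this]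
      exact (hpt.pow_right).add_mul_left_right _
    have hx : ∀ x : ℤ, IsCoprime (p : ℤ) (t - x * (p * r)) := fun x => by
      rw [show t - x * (p * r) = t + p * (-(x * r)) by ring]
      exact hpt.add_mul_left_right _
    rw [one _ _ (hQ.of_isCoprime_of_dvd_right (Int.gcd_dvd_right ..)), one _ _ (hx x₁),
      one _ _ (hx x₂)]
  · have hps' : IsCoprime ((p : ℤ) ^ k) s := ((Prime.coprime_iff_not_dvd hpI).2 hps).pow_left
    obtain ⟨i, j, hij⟩ := id hps'
    have ht : (p : ℤ) ^ k ∣ t - j * t * s := ⟨t * i, by linear_combination -t * hij⟩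
    have hz : ∀ (c : ℕ) (z : ℤ), c ≤ k →
        Int.gcd ((p : ℤ) ^ c) (t - z * s) = Int.gcd ((p : ℤ) ^ c) (j * t - z) := by
      intro c z hc
      have hck : (p : ℤ) ^ c ∣ (p : ℤ) ^ k := pow_dvd_pow _ hc
      rw [← Int.gcd_mul_right_of_isCoprime (s := s) (x := j * t - z)
        (hps'.of_isCoprime_of_dvd_left hck)]
      refine Int.gcd_congr_of_dvd_sub (hck.trans (ht.trans (dvd_of_eq ?_)))
      ring
    rw [hz _ _ h1, hz _ _ h2, ← h7 (j * t)]
    have hs2 : IsCoprime ((p : ℤ) ^ k) (((s ^ 2).natAbs : ℕ) : ℤ) := by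
      rw [Int.natCast_natAbs]
      exact (hps'.pow_right (n := 2)).abs_right
    rw [← Int.gcd_mul_right_of_isCoprime hs2 (x := (Int.gcd (D * (j * t)) _ : ℕ)),
      ← Nat.cast_mul, ← Int.gcd_mul_left]
    refine Int.gcd_gcd_congr ?_ ?_
    · refine (ht.mul_left (D * s)).trans (dvd_of_eq ?_)
      ring
    · refine (ht.mul_left (t + j * t * s + B * s)).trans (dvd_of_eq ?_)
      ring

theorem HasLatticePair.mul {D : ℕ} {B F : ℤ} {M N : ℕ} (hMN : M.Coprime N)
    (hM : HasLatticePair D B F M) (hN : HasLatticePair D B F N) :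
    HasLatticePair D B F (M * N) := by
  obtain ⟨a, e, d, x₁, x₂, h1, h2, h3, h4, h5, h6, h7, h8⟩ := hM
  obtain ⟨a', e', d', x₁', x₂', h1', h2', h3', h4', h5', h6', h7', h8'⟩ := hN
  have crt : ∀ (c c' : ℕ) (x x' : ℤ), c ∣ M → c' ∣ N →
      ∃ z : ℤ, (c : ℤ) ∣ z - x ∧ (c' : ℤ) ∣ z - x' := by
    intro c c' x x' hc hc'
    have : IsCoprime (c : ℤ) (c' : ℤ) := Nat.isCoprime_iff_coprime.2
      ((hMN.coprime_dvd_left hc).coprime_dvd_right hc')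
    obtain ⟨i, j, hij⟩ := this
    refine ⟨x' * (i * c) + x * (j * c'), ⟨(x' - x) * i, ?_⟩, ⟨(x - x') * j, ?_⟩⟩
    · linear_combination x * hij
    · linear_combination x' * hij
  obtain ⟨z₁, hz₁, hz₁'⟩ := crt a a' x₁ x₁' h2 h2'
  obtain ⟨z₂, hz₂, hz₂'⟩ := crt e e' x₂ x₂' h3 h3'
  have mulgcd : ∀ (c c' : ℕ) (z : ℤ), c ∣ M → c' ∣ N →
      Int.gcd ((c * c' : ℕ) : ℤ) z = Int.gcd c z * Int.gcd c' z := by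
    intro c c' z hc hc'
    have : c.Coprime c' := (hMN.coprime_dvd_left hc).coprime_dvd_right hc'
    have h := this.gcd_mul z.natAbs
    simp only [Int.gcd, Int.natAbs_natCast]
    rw [Nat.gcd_comm, h, Nat.gcd_comm z.natAbs c, Nat.gcd_comm z.natAbs c']
  refine ⟨a * a', e * e', d * d', z₁, z₂, Nat.mul_pos h1 h1', mul_dvd_mul h2 h2',
    mul_dvd_mul h3 h3', mul_dvd_mul h4 h4', mul_dvd_mul h5 h5', ?_, ?_, fun s t hst => ?_⟩
  · rw [Nat.cast_mul]
    refine IsCoprime.mul_dvd (Nat.isCoprime_iff_coprime.2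
      ((hMN.coprime_dvd_left (h4.trans h2)).coprime_dvd_right (h4'.trans h2'))) ?_ ?_
    · have ha := (Int.natCast_dvd_natCast.2 h4).trans hz₁
      have he := (Int.natCast_dvd_natCast.2 h5).trans hz₂
      have := dvd_add (dvd_sub ha he) h6
      convert this using 1; ring
    · have ha := (Int.natCast_dvd_natCast.2 h4').trans hz₁'
      have he := (Int.natCast_dvd_natCast.2 h5').trans hz₂'
      have := dvd_add (dvd_sub ha he) h6'
      convert this using 1; ring
  · have hc : (a * e).Coprime (a' * e') := by
      have := Nat.Coprime.mul_left (hMN.coprime_dvd_left h2) (hMN.coprime_dvd_left h3)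
      exact Nat.Coprime.mul_right (this.coprime_dvd_right h2') (this.coprime_dvd_right h3')
    rw [mul_mul_mul_comm]
    refine hc.mul_dvd_of_dvd_of_dvd (h7.trans ⟨d' * N, by ring⟩) (h7'.trans ⟨d * M, by ring⟩)
  · rw [mulgcd M N _ dvd_rfl dvd_rfl, mulgcd a a' _ h2 h2', mulgcd e e' _ h3 h3', h8 s t hst,
      h8' s t hst]
    have tr : ∀ (c : ℕ) (x z : ℤ), (c : ℤ) ∣ z - x →
        Int.gcd c (t - z * s) = Int.gcd c (t - x * s) := fun c x z h =>
      Int.gcd_congr_of_dvd_sub (((dvd_sub_comm.1 h).mul_right s).trans (dvd_of_eq (by ring)))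
    rw [tr a x₁ z₁ hz₁, tr a' x₁' z₁ hz₁', tr e x₂ z₂ hz₂, tr e' x₂' z₂ hz₂']
    ring

theorem hasLatticePair {D : ℕ} (hD : D ≠ 0) (B F : ℤ) {N : ℕ} (hN : N ≠ 0) :
    HasLatticePair D B F N := by
  induction N using Nat.recOnPosPrimePosCoprime with
  | prime_pow p n hp _ => exact hasLatticePair_prime_pow hp n hD B F
  | zero => exact absurd rfl hN
  | one => simpa using hasLatticePair_prime_pow Nat.prime_two 0 hD B F
  | coprime a b ha hb hab iha ihb => exact (iha (by omega)).mul hab (ihb (by omega))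

theorem HasLatticePair.exists_content {D : ℕ} {B F : ℤ} {N : ℕ} (H : HasLatticePair D B F N) :
    ∃ a e d : ℕ, ∃ x₁ x₂ : ℤ, a ∣ N ∧ e ∣ N ∧ d ∣ a ∧ d ∣ e ∧ (d : ℤ) ∣ x₁ - x₂ ∧
      a * e ∣ d * (N * D) ∧ ∀ s t : ℤ,
      Int.gcd (N * s ^ 2) (Int.gcd (D * (s * t)) (t ^ 2 + B * s * t + F * s ^ 2)) =
        Int.gcd (a * s) (t - x₁ * s) * Int.gcd (e * s) (t - x₂ * s) := by
  obtain ⟨a, e, d, x₁, x₂, h1, h2, h3, h4, h5, h6, h7, h8⟩ := H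
  refine ⟨a, e, d, x₁, x₂, h2, h3, h4, h5, h6, h7, fun s t => ?_⟩
  rcases Nat.eq_zero_or_pos (Int.gcd s t) with h0 | hpos
  · obtain ⟨rfl, rfl⟩ := Int.gcd_eq_zero_iff.1 h0
    simp
  obtain ⟨s', t', hst, hs, ht⟩ := Int.exists_gcd_one hpos
  set j : ℤ := (Int.gcd s t : ℤ)
  have hst : IsCoprime s' t' := Int.isCoprime_iff_gcd_eq_one.2 hst
  have lin : ∀ (c : ℕ) (x : ℤ), Int.gcd (c * s) (t - x * s) =
      j.natAbs * Int.gcd c (t' - x * s') := by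
    intro c x
    have hc : IsCoprime s' (t' - x * s') := by
      have := hst.add_mul_left_right (-x)
      rwa [show t' + s' * -x = t' - x * s' by ring] at this
    rw [hs, ht, show (c : ℤ) * (s' * j) = j * (s' * c) by ring,
      show t' * j - x * (s' * j) = j * (t' - x * s') by ring, Int.gcd_mul_left,
      Int.gcd_mul_right_left_of_gcd_eq_one (Int.isCoprime_iff_gcd_eq_one.1 hc)]
  have hc : IsCoprime (s' ^ 2) (Int.gcd (D * (s' * t')) (t' ^ 2 + B * s' * t' + F * s' ^ 2)) := by
    have h9 : IsCoprime s' (t' ^ 2 + B * s' * t' + F * s' ^ 2) := by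
      have := (hst.pow_right (n := 2)).add_mul_left_right (B * t' + F * s')
      rwa [show t' ^ 2 + s' * (B * t' + F * s') = t' ^ 2 + B * s' * t' + F * s' ^ 2 by ring] at this
    exact h9.pow_left.of_isCoprime_of_dvd_right (Int.gcd_dvd_right ..)
  have key := h8 s' t' hst
  rw [← Int.gcd_mul_left_left_of_gcd_eq_one (Int.isCoprime_iff_gcd_eq_one.1 hc)] at key
  rw [lin, lin, mul_mul_mul_comm, ← key]
  rw [hs, ht, show (N : ℤ) * (s' * j) ^ 2 = (j * j) * (N * s' ^ 2) by ring,
    show (D : ℤ) * ((s' * j) * (t' * j)) = (j * j) * (D * (s' * t')) by ring,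
    show (t' * j) ^ 2 + B * (s' * j) * (t' * j) + F * (s' * j) ^ 2 =
      (j * j) * (t' ^ 2 + B * s' * t' + F * s' ^ 2) by ring, Int.gcd_mul_left, Nat.cast_mul]
  have hjj : (((j * j).natAbs : ℕ) : ℤ) = j * j := Int.natAbs_of_nonneg (mul_self_nonneg j)
  rw [hjj, Int.gcd_mul_left, Int.natAbs_mul]

theorem Int.exists_isCoprime_add_mul {e : ℕ} (he : e ≠ 0) {a h : ℤ}
    (H : ∀ p : ℕ, p.Prime → (p : ℤ) ∣ e → (p : ℤ) ∣ a → ¬ (p : ℤ) ∣ h) :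
    ∃ k : ℤ, IsCoprime (e : ℤ) (h + a * k) := by
  classical
  refine ⟨((∏ p ∈ e.primeFactors.filter (fun p : ℕ => ¬ (p : ℤ) ∣ h), p : ℕ) : ℤ), ?_⟩
  rw [Int.isCoprime_iff_gcd_eq_one]
  by_contra hne
  obtain ⟨p, hp, hpd⟩ := Nat.exists_prime_and_dvd hne
  have hpd' : (p : ℤ) ∣ (Int.gcd (e : ℤ) _ : ℕ) := Int.natCast_dvd_natCast.2 hpd
  have hpe : (p : ℤ) ∣ e := hpd'.trans (Int.gcd_dvd_left ..)
  have hph := hpd'.trans (Int.gcd_dvd_right ..)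
  have hpI : Prime (p : ℤ) := Nat.prime_iff_prime_int.1 hp
  by_cases hh : (p : ℤ) ∣ h
  · have hak := (dvd_add_right hh).1 hph
    rcases hpI.dvd_or_dvd hak with ha | hk
    · exact H p hp hpe ha hh
    · obtain ⟨q, hq, hpq⟩ := (hp.prime.dvd_finsetProd_iff _).1 (Int.natCast_dvd_natCast.1 hk)
      rw [Finset.mem_filter, Nat.mem_primeFactors] at hq
      obtain rfl := (Nat.prime_dvd_prime_iff_eq hp hq.1.1).1 hpq
      exact hq.2 hh
  · have hk : p ∣ ∏ p ∈ e.primeFactors.filter (fun p : ℕ => ¬ (p : ℤ) ∣ h), p := by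
      refine Finset.dvd_prod_of_mem (fun p : ℕ => p) (Finset.mem_filter.2 ⟨?_, hh⟩)
      exact Nat.mem_primeFactors.2 ⟨hp, Int.natCast_dvd_natCast.1 hpe, he⟩
    exact hh ((dvd_add_left ((Int.natCast_dvd_natCast.2 hk).mul_left a)).1 hph)

/-- Smith normal form of the pair of linear forms `e s`, `h s + a t`. -/
theorem exists_smith_form {a e : ℕ} (ha : a ≠ 0) (he : e ≠ 0) (h : ℤ) :
    ∃ d n : ℕ, (∀ c : ℕ, c ∣ a → c ∣ e → (c : ℤ) ∣ h → c ∣ d) ∧ n * d ^ 2 = a * e ∧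
      ∃ u₁₁ u₁₂ u₂₁ u₂₂ : ℤ, u₁₁ * u₂₂ - u₁₂ * u₂₁ = 1 ∧ ∀ y z : ℤ,
        Int.gcd (e * (u₁₁ * y + u₁₂ * z))
          (h * (u₁₁ * y + u₁₂ * z) + a * (u₂₁ * y + u₂₂ * z)) = d * Int.gcd y (n * z) := by
  set d := Nat.gcd (Nat.gcd a e) h.natAbs with hd
  have hd0 : d ≠ 0 := by
    rw [hd]; intro h0
    exact ha (Nat.gcd_eq_zero_iff.1 (Nat.gcd_eq_zero_iff.1 h0).1).1
  have hdI : (d : ℤ) ≠ 0 := by exact_mod_cast hd0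
  obtain ⟨a', ha'⟩ : d ∣ a := (Nat.gcd_dvd_left _ _).trans (Nat.gcd_dvd_left _ _)
  obtain ⟨e', he'⟩ : d ∣ e := (Nat.gcd_dvd_left _ _).trans (Nat.gcd_dvd_right _ _)
  obtain ⟨h', hh'⟩ : (d : ℤ) ∣ h := Int.natCast_dvd.2 (Nat.gcd_dvd_right _ _)
  have hgcd : ∀ c : ℕ, c ∣ a → c ∣ e → (c : ℤ) ∣ h → c ∣ d := fun c h1 h2 h3 =>
    Nat.dvd_gcd (Nat.dvd_gcd h1 h2) (Int.natCast_dvd.1 h3)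
  have he'0 : e' ≠ 0 := by rintro rfl; exact he (by simpa using he')
  obtain ⟨k, hk⟩ := Int.exists_isCoprime_add_mul he'0 (a := a') (h := h') (by
    intro p hp h1 h2 h3
    have : d * p ∣ d := by
      apply hgcd
      · rw [ha']; exact mul_dvd_mul_left _ (Int.natCast_dvd_natCast.1 h2)
      · rw [he']; exact mul_dvd_mul_left _ (Int.natCast_dvd_natCast.1 h1)
      · rw [hh', Nat.cast_mul]; exact mul_dvd_mul_left _ h3
    have h5 : d * p ∣ d * 1 := by simpa using this
    exact hp.one_lt.ne' (Nat.dvd_one.1 (Nat.dvd_of_mul_dvd_mul_left (Nat.pos_of_ne_zero hd0) h5)))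
  obtain ⟨p, q, hpq⟩ := hk
  refine ⟨d, a' * e', hgcd, by rw [ha', he']; ring,
    1, -(q * a'), k, 1 - k * q * a', by ring, fun y z => ?_⟩
  have e1 : (e : ℤ) * (1 * y + -(q * a') * z) = d * (e' * y - q * (a' * e' * z)) := by
    rw [he']; push_cast; ring
  have e2 : h * (1 * y + -(q * a') * z) + a * (k * y + (1 - k * q * a') * z) =
      d * ((h' + a' * k) * y + p * (a' * e' * z)) := by
    rw [ha', hh']; push_cast
    linear_combination -(d * a' * z : ℤ) * hpq
  rw [e1, e2, Int.gcd_mul_left, Int.natAbs_natCast, Nat.cast_mul]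
  congr 1
  have hy : y = p * (e' * y - q * (a' * e' * z)) +
      q * ((h' + a' * k) * y + p * (a' * e' * z)) := by linear_combination -y * hpq
  have hz : (a' : ℤ) * e' * z = e' * ((h' + a' * k) * y + p * (a' * e' * z)) -
      (h' + a' * k) * (e' * y - q * (a' * e' * z)) := by
    linear_combination -(a' * e' * z : ℤ) * hpq
  apply Nat.dvd_antisymm
  · refine Int.natCast_dvd_natCast.1 (Int.dvd_coe_gcd ?_ ?_)
    · exact (dvd_add ((Int.gcd_dvd_left ..).mul_left _) ((Int.gcd_dvd_right ..).mul_left _)).trans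
        (dvd_of_eq hy.symm)
    · exact (dvd_sub ((Int.gcd_dvd_right ..).mul_left _) ((Int.gcd_dvd_left ..).mul_left _)).trans
        (dvd_of_eq hz.symm)
  · refine Int.natCast_dvd_natCast.1 (Int.dvd_coe_gcd ?_ ?_)
    · exact dvd_sub ((Int.gcd_dvd_left ..).mul_left _) ((Int.gcd_dvd_right ..).mul_left _)
    · exact dvd_add ((Int.gcd_dvd_left ..).mul_left _) ((Int.gcd_dvd_right ..).mul_left _)

/-- The integer point of the conic with homogeneous parameter `(S, T)`. -/
def conicVec (A B C D S T : ℤ) : Fin 3 → ℤ :=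
  ![D * S ^ 2, D * S * T, A * S ^ 2 + B * S * T + C * T ^ 2]

/-- The greatest common divisor of the coordinates of an integer vector. -/
def vecContent (V : Fin 3 → ℤ) : ℕ := Int.gcd (V 0) (Int.gcd (V 1) (V 2))

theorem exists_reparametrization (A B C D : ℤ) (hC : 1 ≤ C) (hD : 1 ≤ D) :
    ∃ m n : ℕ, 0 < m ∧ 0 < n ∧ ((m : ℤ) * (n : ℤ)) ∣ C * D ^ 2 ∧
      ∃ a b c d : ℤ, a * d - b * c ≠ 0 ∧ ∀ s t : ℤ, IsCoprime s t →
        vecContent (conicVec A B C D (a * s + b * t) (c * s + d * t)) =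
          m * (a * d - b * c).natAbs * Int.gcd t n := by
  lift C to ℕ using by omega
  lift D to ℕ using by omega
  have hC0 : C ≠ 0 := by rintro rfl; simp at hC
  have hD0 : D ≠ 0 := by rintro rfl; simp at hD
  obtain ⟨a, e, d₀, x₁, x₂, h1, h2, h3, h4, h5, h6, h7⟩ :=
    (hasLatticePair hD0 B (A * C) (mul_ne_zero hC0 hD0)).exists_content
  have ha : a ≠ 0 := ne_zero_of_dvd_ne_zero (mul_ne_zero hC0 hD0) h1
  have he : e ≠ 0 := ne_zero_of_dvd_ne_zero (mul_ne_zero hC0 hD0) h2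
  obtain ⟨d, n, hd, hn, u₁₁, u₁₂, u₂₁, u₂₂, hu, hgcd⟩ := exists_smith_form ha he (x₁ - x₂)
  have hne : n * d ^ 2 ≠ 0 := by rw [hn]; exact mul_ne_zero ha he
  have hn0 : n ≠ 0 := left_ne_zero_of_mul hne
  have hd0 : d ≠ 0 := by rintro rfl; simp at hne
  have hdet : C * u₁₂ * (a * u₂₁ + x₁ * u₁₁) - C * u₁₁ * (a * u₂₂ + x₁ * u₁₂) = -(C * a : ℤ) := by
    linear_combination -(C * a : ℤ) * hu
  refine ⟨d, n, Nat.pos_of_ne_zero hd0, Nat.pos_of_ne_zero hn0, ?_,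
    C * u₁₂, C * u₁₁, a * u₂₂ + x₁ * u₁₂, a * u₂₁ + x₁ * u₁₁, ?_, fun s t hst => ?_⟩
  · have : d * (d * n) ∣ d * (C * D * D) := by
      rw [show d * (d * n) = a * e by rw [← hn]; ring]
      exact h6.trans (mul_dvd_mul_right (hd _ h3 h4 h5) _)
    have := Nat.dvd_of_mul_dvd_mul_left (Nat.pos_of_ne_zero hd0) this
    have := Int.natCast_dvd_natCast.2 this
    push_cast at this
    rwa [mul_assoc, ← sq] at this
  · rw [hdet, neg_ne_zero]
    exact_mod_cast mul_ne_zero hC0 ha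
  · rw [hdet, Int.natAbs_neg, Int.natAbs_mul, Int.natAbs_natCast, Int.natAbs_natCast]
    set y := u₁₁ * t + u₁₂ * s with hy
    set z := u₂₁ * t + u₂₂ * s with hz
    have hyz : Int.gcd y z = 1 := by
      rw [← Int.isCoprime_iff_gcd_eq_one]
      obtain ⟨i, j, hij⟩ := hst
      refine ⟨j * u₂₂ - i * u₂₁, i * u₁₁ - j * u₁₂, ?_⟩
      rw [hy, hz]
      linear_combination hij + (i * s + j * t) * hu
    have hcont := h7 y (a * z + x₁ * y)
    rw [show (a : ℤ) * z + x₁ * y - x₁ * y = a * z by ring,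
      show (a : ℤ) * z + x₁ * y - x₂ * y = (x₁ - x₂) * y + a * z by ring,
      hgcd, Int.gcd_mul_left, hyz, Int.natAbs_natCast] at hcont
    have hlast : Int.gcd t (n * s) = Int.gcd t n := by
      rw [Int.gcd_comm t, Int.gcd_comm t]
      exact Int.gcd_mul_left_left_of_gcd_eq_one (Int.isCoprime_iff_gcd_eq_one.1 hst)
    rw [hlast] at hcont
    simp only [vecContent, conicVec, Matrix.cons_val_zero, Matrix.cons_val_one, Matrix.cons_val]
    rw [show C * u₁₂ * s + C * u₁₁ * t = C * y by rw [hy]; ring,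
      show (a * u₂₂ + x₁ * u₁₂) * s + (a * u₂₁ + x₁ * u₁₁) * t = a * z + x₁ * y by
        rw [hy, hz]; ring]
    set w := (a : ℤ) * z + x₁ * y
    rw [show (D : ℤ) * (C * y) ^ 2 = C * ((C * D : ℕ) * y ^ 2) by push_cast; ring,
      show (D : ℤ) * (C * y) * w = C * (D * (y * w)) by ring,
      show A * (C * y) ^ 2 + B * (C * y) * w + C * w ^ 2 =
        C * (w ^ 2 + B * y * w + A * C * y ^ 2) by ring, Int.gcd_mul_left, Int.natAbs_natCast,
      Nat.cast_mul C (Int.gcd _ _), Int.gcd_mul_left, Int.natAbs_natCast, hcont]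
    ring

theorem vecContent_dvd (V : Fin 3 → ℤ) (j : Fin 3) : (vecContent V : ℤ) ∣ V j := by
  have h0 : (vecContent V : ℤ) ∣ V 0 := Int.gcd_dvd_left ..
  have h : (vecContent V : ℤ) ∣ (Int.gcd (V 1) (V 2) : ℕ) := Int.gcd_dvd_right ..
  have h1 : (vecContent V : ℤ) ∣ V 1 := h.trans (Int.gcd_dvd_left ..)
  have h2 : (vecContent V : ℤ) ∣ V 2 := h.trans (Int.gcd_dvd_right ..)
  fin_cases j
  exacts [h0, h1, h2]

/-- An integer vector proportional to `V` is an integer multiple of `V / vecContent V`. -/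
theorem exists_vecContent_mul_eq {P V : Fin 3 → ℤ} (h : ∀ i j, P i * V j = P j * V i) :
    ∃ k : ℤ, ∀ j, vecContent V * P j = k * V j := by
  set x := Int.gcdA (V 0) (Int.gcd (V 1) (V 2))
  set y := Int.gcdB (V 0) (Int.gcd (V 1) (V 2))
  set z := Int.gcdA (V 1) (V 2)
  set w := Int.gcdB (V 1) (V 2)
  have h1 : (vecContent V : ℤ) = V 0 * x + Int.gcd (V 1) (V 2) * y := Int.gcd_eq_gcd_ab _ _
  have h2 : (Int.gcd (V 1) (V 2) : ℤ) = V 1 * z + V 2 * w := Int.gcd_eq_gcd_ab _ _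
  refine ⟨P 0 * x + (P 1 * z + P 2 * w) * y, fun j => ?_⟩
  rw [h1, h2]
  linear_combination -x * h 0 j - z * y * h 1 j - w * y * h 2 j

/-- The real point of the conic with homogeneous parameter `(S, T)`. -/
def conicPt (A B C D : ℤ) (S T : ℝ) : V3 :=
  ![D * S ^ 2, D * S * T, A * S ^ 2 + B * S * T + C * T ^ 2]

theorem intCast3_conicVec (A B C D S T : ℤ) :
    intCast3 (conicVec A B C D S T) = conicPt A B C D S T := by
  funext i
  fin_cases i <;> simp [intCast3, conicVec, conicPt]

theorem Phi6_conicPt (A B C D : ℤ) (S T : ℝ) :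
    Phi6 (-A) (-B) (-C) D 0 0 (conicPt A B C D S T) = 0 := by
  simp [Phi6, conicPt]; ring

theorem bil_smul_right (A B C D : ℤ) (x : ℝ) (P Q : V3) :
    bil (Phi6 A B C D 0 0) P (x • Q) = x * bil (Phi6 A B C D 0 0) P Q := by
  simp [bil, Phi6]; ring

theorem Phi6_smul (A B C D : ℤ) (x : ℝ) (P : V3) :
    Phi6 A B C D 0 0 (x • P) = x ^ 2 * Phi6 A B C D 0 0 P := by
  simp [Phi6]; ring

theorem bil_conicPt (A B C D : ℤ) (P : V3) (S T : ℝ) :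
    bil (Phi6 (-A) (-B) (-C) D 0 0) P (conicPt A B C D S T) =
      D / 2 * ((D * P 2 - A * P 0 - B * P 1) * S ^ 2 - 2 * C * P 1 * S * T + C * P 0 * T ^ 2) := by
  simp [bil, Phi6, conicPt]; ring

theorem conicPt_ne_zero {A B C D : ℤ} (hC : 1 ≤ C) (hD : 1 ≤ D) {S T : ℝ} (h : S ≠ 0 ∨ T ≠ 0) :
    conicPt A B C D S T ≠ 0 := by
  intro h0
  have hC' : (C : ℝ) ≠ 0 := by exact_mod_cast (by omega : C ≠ 0)
  have hD' : (D : ℝ) ≠ 0 := by exact_mod_cast (by omega : D ≠ 0)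
  have e0 := congrFun h0 0
  have e2 := congrFun h0 2
  have hS : S = 0 := by simpa [conicPt, hD'] using e0
  have hT : T = 0 := by simpa [conicPt, hC', hS] using e2
  simp [hS, hT] at h

/-- A point orthogonal to all of the conic vanishes. -/
theorem eq_zero_of_bil_conicPt {A B C D : ℤ} (hC : 1 ≤ C) (hD : 1 ≤ D) {P : V3}
    (h : ∀ S T, bil (Phi6 (-A) (-B) (-C) D 0 0) P (conicPt A B C D S T) = 0) : P = 0 := by
  have hC' : (C : ℝ) ≠ 0 := by exact_mod_cast (by omega : C ≠ 0)
  have hD' : (D : ℝ) ≠ 0 := by exact_mod_cast (by omega : D ≠ 0)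
  have e1 := h 0 1
  have e2 := h 1 0
  have e3 := h 1 1
  rw [bil_conicPt] at e1 e2 e3
  have x0 : P 0 = 0 := by simpa [hC', hD'] using e1
  have x1 : P 1 = 0 := by
    have : D * C * P 1 = 0 := by linear_combination e1 + e2 - e3
    simpa [hC', hD'] using this
  have x2 : P 2 = 0 := by simpa [hD', x0, x1] using e2
  funext i
  fin_cases i
  exacts [x0, x1, x2]

/-- On the tangent line at a point of the conic the form vanishes at that point only. -/
theorem eq_smul_of_bil_eq_zero {A B C D : ℤ} (hC : 1 ≤ C) (hD : 1 ≤ D) {P : V3} {S T : ℝ}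
    (hS : S ≠ 0) (h : bil (Phi6 (-A) (-B) (-C) D 0 0) P (conicPt A B C D S T) = 0)
    (hP : Phi6 (-A) (-B) (-C) D 0 0 P = 0) : ∃ c : ℝ, P = c • conicPt A B C D S T := by
  have hC' : (C : ℝ) ≠ 0 := by exact_mod_cast (by omega : C ≠ 0)
  have hD' : (D : ℝ) ≠ 0 := by exact_mod_cast (by omega : D ≠ 0)
  rw [bil_conicPt] at h
  have h' : (D * P 2 - A * P 0 - B * P 1) * S ^ 2 - 2 * C * P 1 * S * T + C * P 0 * T ^ 2 = 0 := by
    simpa [hD'] using h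
  have hP' : D * P 0 * P 2 = A * P 0 ^ 2 + B * P 0 * P 1 + C * P 1 ^ 2 := by
    simp only [Phi6] at hP
    push_cast at hP
    linear_combination hP
  have h1 : (C * (P 0 * T - P 1 * S)) ^ 2 = 0 := by
    linear_combination C * P 0 * h' - C * S ^ 2 * hP'
  have h1' : P 0 * T - P 1 * S = 0 := by simpa [hC'] using h1
  have h2 : P 1 = P 0 * T / S := by field_simp; linear_combination -h1'
  have h3 : P 2 = P 0 / (D * S ^ 2) * (A * S ^ 2 + B * S * T + C * T ^ 2) := by
    rw [h2] at h'
    field_simp at h' ⊢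
    linear_combination h'
  refine ⟨P 0 / (D * S ^ 2), ?_⟩
  funext i
  fin_cases i
  · simp [conicPt]; field_simp
  · simp [conicPt]; rw [h2]; field_simp
  · simpa [conicPt] using h3

/-- The quadratic form `⟨P, ·⟩` on the parametrized conic, given one root `ξ`. -/
theorem exists_bil_eq_mul {A B C D a b c d : ℤ} (hC : 1 ≤ C) (hdet : a * d - b * c ≠ 0)
    {P : V3} {ξ : ℝ}
    (h : bil (Phi6 (-A) (-B) (-C) D 0 0) P (conicPt A B C D (a * ξ + b) (c * ξ + d)) = 0) :
    ∃ k l : ℝ, (∀ s t : ℝ, bil (Phi6 (-A) (-B) (-C) D 0 0) P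
        (conicPt A B C D (a * s + b * t) (c * s + d * t)) = (s - ξ * t) * (k * s + l * t)) ∧
      Real.sqrt (C * (D : ℝ) ^ 2 * |Phi6 (-A) (-B) (-C) D 0 0 P|) =
        |k * ξ + l| / |((a * d - b * c : ℤ) : ℝ)| := by
  have hdet' : ((a * d - b * c : ℤ) : ℝ) ≠ 0 := by exact_mod_cast hdet
  have hC' : (0 : ℝ) ≤ C := by exact_mod_cast (by omega : 0 ≤ C)
  rw [bil_conicPt] at h
  set p : ℝ := D / 2 * (D * P 2 - A * P 0 - B * P 1) with hp
  set q : ℝ := -D * C * P 1 with hq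
  set r : ℝ := D / 2 * C * P 0 with hr
  set p' : ℝ := p * a ^ 2 + q * a * c + r * c ^ 2 with hp'
  set q' : ℝ := 2 * p * a * b + q * (a * d + b * c) + 2 * r * c * d with hq'
  set r' : ℝ := p * b ^ 2 + q * b * d + r * d ^ 2 with hr'
  have hroot : p' * ξ ^ 2 + q' * ξ + r' = 0 := by
    rw [← h, hp', hq', hr', hp, hq, hr]; ring
  refine ⟨p', q' + p' * ξ, fun s t => ?_, ?_⟩
  · rw [bil_conicPt]
    have : (s - ξ * t) * (p' * s + (q' + p' * ξ) * t) = p' * s ^ 2 + q' * s * t + r' * t ^ 2 := by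
      linear_combination -t ^ 2 * hroot
    rw [this, hp', hq', hr', hp, hq, hr]; ring
  · have hdisc : (p' * ξ + (q' + p' * ξ)) ^ 2 =
        ((a * d - b * c : ℤ) : ℝ) ^ 2 * -(C * D ^ 2 * Phi6 (-A) (-B) (-C) D 0 0 P) := by
      have e1 : (p' * ξ + (q' + p' * ξ)) ^ 2 = q' ^ 2 - 4 * p' * r' := by
        linear_combination 4 * p' * hroot
      rw [e1, hp', hq', hr', hp, hq, hr, Phi6]
      push_cast
      ring
    rw [← abs_div, ← Real.sqrt_sq_eq_abs ((p' * ξ + _) / _), div_pow, hdisc,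
      mul_div_cancel_left₀ _ (pow_ne_zero 2 hdet')]
    congr 1
    have hnn : 0 ≤ -(C * (D : ℝ) ^ 2 * Phi6 (-A) (-B) (-C) D 0 0 P) := by
      have := sq_nonneg (p' * ξ + (q' + p' * ξ))
      rw [hdisc] at this
      exact nonneg_of_mul_nonneg_right this (by positivity)
    rw [← abs_of_nonneg hnn, abs_neg, abs_mul, abs_of_nonneg (by positivity : 0 ≤ C * (D : ℝ) ^ 2)]

theorem Phi6_intCast3 {A B C D : ℤ} {P : Fin 3 → ℤ}
    (h : Phi6 (-A) (-B) (-C) D 0 0 (intCast3 P) = 0) :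
    D * P 0 * P 2 = A * P 0 ^ 2 + B * P 0 * P 1 + C * P 1 ^ 2 := by
  have : (D : ℝ) * P 0 * P 2 = A * P 0 ^ 2 + B * P 0 * P 1 + C * P 1 ^ 2 := by
    simp only [Phi6, intCast3] at h
    push_cast at h
    linear_combination h
  exact_mod_cast this

theorem proportional_conicVec {A B C D : ℤ} {P : Fin 3 → ℤ}
    (hP : Phi6 (-A) (-B) (-C) D 0 0 (intCast3 P) = 0) (h0 : P 0 ≠ 0) {S T : ℤ}
    (h : S * P 1 = T * P 0) (i j : Fin 3) :
    P i * conicVec A B C D S T j = P j * conicVec A B C D S T i := by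
  have hP' := Phi6_intCast3 hP
  have e1 : P 0 * (D * S * T) = P 1 * (D * S ^ 2) := by linear_combination -D * S * h
  have e2 : P 0 * (A * S ^ 2 + B * S * T + C * T ^ 2) = P 2 * (D * S ^ 2) := by
    refine mul_left_cancel₀ h0 ?_
    linear_combination -S ^ 2 * hP' - B * P 0 * S * h - C * (P 0 * T + S * P 1) * h
  have e3 : P 1 * (A * S ^ 2 + B * S * T + C * T ^ 2) = P 2 * (D * S * T) := by
    refine mul_left_cancel₀ h0 ?_
    linear_combination P 1 * e2 - P 2 * e1
  fin_cases i <;> fin_cases j <;>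
    simp only [conicVec, Fin.zero_eta, Fin.mk_one, Fin.reduceFinMk, Matrix.cons_val_zero,
      Matrix.cons_val_one, Matrix.cons_val] <;>
    first | rfl | linarith

theorem exists_isCoprime_proportional {A B C D a b c d : ℤ} (hC : 1 ≤ C)
    (hdet : a * d - b * c ≠ 0) {P : Fin 3 → ℤ}
    (hP : Phi6 (-A) (-B) (-C) D 0 0 (intCast3 P) = 0) :
    ∃ s t : ℤ, IsCoprime s t ∧ ∀ i j,
      P i * conicVec A B C D (a * s + b * t) (c * s + d * t) j =
        P j * conicVec A B C D (a * s + b * t) (c * s + d * t) i := by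
  obtain ⟨S, T, hST, hprop⟩ : ∃ S T : ℤ, (S ≠ 0 ∨ T ≠ 0) ∧ ∀ S' T' : ℤ, S' * T = T' * S →
      ∀ i j, P i * conicVec A B C D S' T' j = P j * conicVec A B C D S' T' i := by
    by_cases h0 : P 0 = 0
    · have h1 : P 1 = 0 := by
        have := Phi6_intCast3 hP
        have hC' : C ≠ 0 := by omega
        simpa [h0, hC'] using this.symm
      refine ⟨0, 1, by simp, fun S' T' h i j => ?_⟩
      obtain rfl : S' = 0 := by simpa using h
      fin_cases i <;> fin_cases j <;> simp [conicVec, h0, h1]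
    · exact ⟨P 0, P 1, Or.inl h0, fun S' T' h => proportional_conicVec hP h0 h⟩
  have hpos : 0 < Int.gcd (d * S - b * T) (a * T - c * S) := by
    rw [Nat.pos_iff_ne_zero]
    intro h0
    obtain ⟨h1, h2⟩ := Int.gcd_eq_zero_iff.1 h0
    have e1 : (a * d - b * c) * S = 0 := by linear_combination a * h1 + b * h2
    have e2 : (a * d - b * c) * T = 0 := by linear_combination c * h1 + d * h2
    simp only [mul_eq_zero, hdet, false_or] at e1 e2
    simp [e1, e2] at hST
  obtain ⟨s, t, hst, hs, ht⟩ := Int.exists_gcd_one hpos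
  have hpos' : (Int.gcd (d * S - b * T) (a * T - c * S) : ℤ) ≠ 0 := by exact_mod_cast hpos.ne'
  refine ⟨s, t, Int.isCoprime_iff_gcd_eq_one.2 hst, hprop _ _ ?_⟩
  refine mul_right_cancel₀ hpos' ?_
  linear_combination (c * S - a * T) * hs + (d * S - b * T) * ht

theorem exists_smul_intCast3_eq {A B C D : ℤ} (hC : 1 ≤ C) (hD : 1 ≤ D) {S T : ℤ}
    (h : S ≠ 0 ∨ T ≠ 0) :
    ∃ P : ConicPts (Phi6 (-A) (-B) (-C) D 0 0),
      conicPt A B C D S T = (vecContent (conicVec A B C D S T) : ℝ) • intCast3 P.1 := by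
  choose P hP using vecContent_dvd (conicVec A B C D S T)
  have e : conicPt A B C D S T = (vecContent (conicVec A B C D S T) : ℝ) • intCast3 P := by
    rw [← intCast3_conicVec]
    funext j
    have := congrArg (Int.cast : ℤ → ℝ) (hP j)
    simpa [intCast3] using this
  have hne : conicPt A B C D S T ≠ 0 :=
    conicPt_ne_zero hC hD (by exact_mod_cast h)
  have hN : (vecContent (conicVec A B C D S T) : ℝ) ≠ 0 := by
    intro h0
    rw [h0, zero_smul] at e
    exact hne e
  refine ⟨⟨P, ?_, ?_⟩, e⟩
  · rintro h0
    rw [h0, smul_zero] at e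
    exact hne e
  · have := Phi6_conicPt A B C D S T
    rw [e, Phi6_smul] at this
    simpa [hN] using this

theorem exists_mul_bil_eq {A B C D : ℤ} (hC : 1 ≤ C) (hD : 1 ≤ D) {S T : ℤ} (h : S ≠ 0 ∨ T ≠ 0)
    {P : Fin 3 → ℤ} (hP : intCast3 P ≠ 0)
    (hprop : ∀ i j, P i * conicVec A B C D S T j = P j * conicVec A B C D S T i) (Sg : V3) :
    ∃ k : ℤ, k ≠ 0 ∧ vecContent (conicVec A B C D S T) *
      bil (Phi6 (-A) (-B) (-C) D 0 0) Sg (intCast3 P) =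
        k * bil (Phi6 (-A) (-B) (-C) D 0 0) Sg (conicPt A B C D S T) := by
  obtain ⟨k, hk⟩ := exists_vecContent_mul_eq hprop
  have e : (vecContent (conicVec A B C D S T) : ℝ) • intCast3 P =
      (k : ℝ) • conicPt A B C D S T := by
    rw [← intCast3_conicVec]
    funext j
    have := congrArg (Int.cast : ℤ → ℝ) (hk j)
    simpa [intCast3] using this
  refine ⟨k, ?_, ?_⟩
  · rintro rfl
    obtain ⟨Q, hQ⟩ := exists_smul_intCast3_eq (A := A) (B := B) hC hD h
    have hne : conicPt A B C D S T ≠ 0 := conicPt_ne_zero hC hD (by exact_mod_cast h)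
    rw [Int.cast_zero, zero_smul, smul_eq_zero] at e
    rcases e with e | e
    · rw [e, zero_smul] at hQ
      exact hne hQ
    · exact hP e
  · rw [← bil_smul_right, ← bil_smul_right, e]

theorem div_div_abs_eq {K δ g m x y k : ℝ} (hδ : 0 < δ) (hm : 0 < m) (hg : 0 < g)
    (h : m * δ * g * x = k * y) : K / δ / |x| = m * (K * g / |y|) / |k| := by
  have hx : x = k * y / (m * δ * g) := by field_simp; linear_combination h
  rw [hx, abs_div, abs_mul, abs_of_pos (by positivity : 0 < m * δ * g)]
  field_simp

theorem Irrational.intCast_sub_mul_ne_zero {ξ : ℝ} (hξ : Irrational ξ) {s t : ℤ}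
    (h : s ≠ 0 ∨ t ≠ 0) : (s : ℝ) - t * ξ ≠ 0 := by
  rcases eq_or_ne t 0 with rfl | ht
  · simpa using h
  · have := (hξ.intCast_mul ht).intCast_sub s
    exact this.ne_zero

theorem map_ne_zero_of_det {a b c d : ℤ} (hdet : a * d - b * c ≠ 0) {s t : ℤ}
    (h : s ≠ 0 ∨ t ≠ 0) : a * s + b * t ≠ 0 ∨ c * s + d * t ≠ 0 := by
  by_contra! hcon
  have e1 : (a * d - b * c) * s = 0 := by linear_combination d * hcon.1 - b * hcon.2
  have e2 : (a * d - b * c) * t = 0 := by linear_combination a * hcon.2 - c * hcon.1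
  simp only [mul_eq_zero, hdet, false_or] at e1 e2
  simp [e1, e2] at h

theorem IsCoprime.ne_zero_or_ne_zero_int {s t : ℤ} (h : IsCoprime s t) : s ≠ 0 ∨ t ≠ 0 := by
  by_contra! hcon
  rw [hcon.1, hcon.2] at h
  exact not_isCoprime_zero_zero h

theorem muPhi_eq {A B C D a b c d : ℤ} {m n : ℕ} (hC : 1 ≤ C) (hD : 1 ≤ D) (hm : 0 < m)
    (hn : 0 < n) (hdet : a * d - b * c ≠ 0)
    (hcont : ∀ s t : ℤ, IsCoprime s t →
      vecContent (conicVec A B C D (a * s + b * t) (c * s + d * t)) =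
        m * (a * d - b * c).natAbs * Int.gcd t n)
    {ξ ξ' : ℝ} (hξ : Irrational ξ) (hξ' : Irrational ξ') (hne : ξ ≠ ξ') {Sg : V3} (hSg : Sg ≠ 0)
    (h : bil (Phi6 (-A) (-B) (-C) D 0 0) Sg (conicPt A B C D (a * ξ + b) (c * ξ + d)) = 0)
    (h' : bil (Phi6 (-A) (-B) (-C) D 0 0) Sg (conicPt A B C D (a * ξ' + b) (c * ξ' + d)) = 0) :
    muPhi (Phi6 (-A) (-B) (-C) D 0 0) ((C : ℝ) * (D : ℝ) ^ 2) Sg =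
      (m : ℝ≥0∞) * nMarkoff n ξ ξ' := by
  have hdet' : ((a * d - b * c : ℤ) : ℝ) ≠ 0 := by exact_mod_cast hdet
  obtain ⟨k, l, hkl, hsqrt⟩ := exists_bil_eq_mul hC hdet h
  have hl : l = -k * ξ' := by
    have := hkl ξ' 1
    simp only [mul_one] at this
    rw [h', eq_comm, mul_eq_zero] at this
    rcases this with h0 | h0
    · exact absurd (sub_eq_zero.1 h0).symm hne
    · linear_combination h0
  subst hl
  have hk : k ≠ 0 := by
    rintro rfl
    refine hSg (eq_zero_of_bil_conicPt (A := A) (B := B) hC hD fun S T => ?_)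
    have := hkl ((d * S - b * T) / (a * d - b * c : ℤ)) ((a * T - c * S) / (a * d - b * c : ℤ))
    have e1 : (a : ℝ) * ((d * S - b * T) / (a * d - b * c : ℤ)) +
        b * ((a * T - c * S) / (a * d - b * c : ℤ)) = S := by
      field_simp; push_cast; ring
    have e2 : (c : ℝ) * ((d * S - b * T) / (a * d - b * c : ℤ)) +
        d * ((a * T - c * S) / (a * d - b * c : ℤ)) = T := by
      field_simp; push_cast; ring
    rw [e1, e2] at this
    rw [this]; ring
  have hK : Real.sqrt (C * (D : ℝ) ^ 2 * |Phi6 (-A) (-B) (-C) D 0 0 Sg|) =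
      |k| * |ξ - ξ'| / |((a * d - b * c : ℤ) : ℝ)| := by
    rw [hsqrt, ← abs_mul]; ring_nf
  have hmR : (0 : ℝ) < m := by exact_mod_cast hm
  have hg : ∀ t : ℤ, (0 : ℝ) < Int.gcd t n := fun t => by
    exact_mod_cast Int.gcd_pos_of_ne_zero_right t (by exact_mod_cast hn.ne')
  -- the value at a multiple of a primitive parametrized point
  have hval : ∀ (s t : ℤ), IsCoprime s t → ∀ (x j : ℝ),
      (vecContent (conicVec A B C D (a * s + b * t) (c * s + d * t)) : ℝ) * x =
        j * bil (Phi6 (-A) (-B) (-C) D 0 0) Sg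
          (conicPt A B C D ((a * s + b * t : ℤ) : ℝ) ((c * s + d * t : ℤ) : ℝ)) →
      Real.sqrt (C * (D : ℝ) ^ 2 * |Phi6 (-A) (-B) (-C) D 0 0 Sg|) / |x| =
        m * (|ξ - ξ'| * Int.gcd t n / |((s : ℝ) - t * ξ) * (s - t * ξ')|) / |j| := by
    intro s t hst x j hx
    rw [hcont s t hst] at hx
    push_cast at hx hkl
    rw [hkl] at hx
    rw [hK, div_div_abs_eq (g := Int.gcd t n) (k := j)
      (y := k * (((s : ℝ) - t * ξ) * (s - t * ξ'))) (abs_pos.2 hdet') hmR (hg t)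
      (by
        rw [Nat.cast_natAbs] at hx
        push_cast at hx ⊢
        rw [hx]; ring)]
    rw [abs_mul k, mul_assoc |k|, mul_div_mul_left _ _ (abs_ne_zero.2 hk)]
  apply le_antisymm
  · refine iSup_le fun P => iSup_le fun hP => iSup_le fun hP0 => iSup_le fun _ => ?_
    obtain ⟨s, t, hst, hprop⟩ := exists_isCoprime_proportional (a := a) (b := b) (c := c) (d := d)
      hC hdet hP0
    have hst0 := hst.ne_zero_or_ne_zero_int
    obtain ⟨j, hj, hj'⟩ := exists_mul_bil_eq hC hD (map_ne_zero_of_det hdet hst0) hP hprop Sg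
    rw [hval s t hst _ j hj']
    have hj1 : (1 : ℝ) ≤ |(j : ℝ)| := by exact_mod_cast Int.one_le_abs hj
    calc _ ≤ ENNReal.ofReal
          (m * (|ξ - ξ'| * Int.gcd t n / |((s : ℝ) - t * ξ) * (s - t * ξ')|)) :=
          ENNReal.ofReal_le_ofReal (div_le_self (by positivity) hj1)
      _ = m * ENNReal.ofReal (|ξ - ξ'| * Int.gcd t n / |((s : ℝ) - t * ξ) * (s - t * ξ')|) := by
          rw [ENNReal.ofReal_mul hmR.le, ENNReal.ofReal_natCast]
      _ ≤ _ := by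
          gcongr
          exact le_iSup₂_of_le (s, t) (by simpa [Prod.ext_iff, imp_iff_not_or] using hst0) le_rfl
  · rw [nMarkoff, ENNReal.mul_iSup]
    refine iSup_le fun st => ?_
    rw [ENNReal.mul_iSup]
    refine iSup_le fun hst => ?_
    obtain ⟨s₀, t₀⟩ := st
    have hst' : s₀ ≠ 0 ∨ t₀ ≠ 0 := by simpa [Prod.ext_iff, imp_iff_not_or] using hst
    have hpos : 0 < Int.gcd s₀ t₀ := by
      rcases hst' with h | h
      · exact Int.gcd_pos_of_ne_zero_left _ h
      · exact Int.gcd_pos_of_ne_zero_right _ h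
    obtain ⟨s, t, hcop, hs, ht⟩ := Int.exists_gcd_one hpos
    set j : ℕ := Int.gcd s₀ t₀
    have hcop := Int.isCoprime_iff_gcd_eq_one.2 hcop
    have hst0 := hcop.ne_zero_or_ne_zero_int
    obtain ⟨P, hP⟩ := exists_smul_intCast3_eq (A := A) (B := B) hC hD (map_ne_zero_of_det hdet hst0)
    have hbil : (vecContent (conicVec A B C D (a * s + b * t) (c * s + d * t)) : ℝ) *
        bil (Phi6 (-A) (-B) (-C) D 0 0) Sg (intCast3 P.1) =
        1 * bil (Phi6 (-A) (-B) (-C) D 0 0) Sg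
          (conicPt A B C D ((a * s + b * t : ℤ) : ℝ) ((c * s + d * t : ℤ) : ℝ)) := by
      rw [hP, bil_smul_right, one_mul]
    have hne0 : bil (Phi6 (-A) (-B) (-C) D 0 0) Sg (intCast3 P.1) ≠ 0 := by
      intro h0
      push_cast at hkl hbil
      rw [h0, hkl, mul_zero, one_mul, eq_comm] at hbil
      have e1 := hξ.intCast_sub_mul_ne_zero hst0
      have e2 := hξ'.intCast_sub_mul_ne_zero hst0
      have : k * (((s : ℝ) - t * ξ) * (s - t * ξ')) = 0 := by linear_combination hbil
      simp [hk, e1, e2] at this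
    refine le_iSup_of_le P.1 (le_iSup_of_le P.2.1 (le_iSup_of_le P.2.2 (le_iSup_of_le hne0 ?_)))
    rw [hval s t hcop _ 1 hbil, abs_one, div_one, ENNReal.ofReal_mul hmR.le,
      ENNReal.ofReal_natCast]
    refine mul_le_mul' le_rfl (ENNReal.ofReal_le_ofReal ?_)
    change |ξ - ξ'| * Int.gcd t₀ n / |((s₀ : ℝ) - t₀ * ξ) * (s₀ - t₀ * ξ')| ≤ _
    have hjR : (1 : ℝ) ≤ j := by exact_mod_cast hpos
    have hgle : (Int.gcd t₀ n : ℝ) ≤ j * Int.gcd t n := by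
      have : Int.gcd t₀ n ∣ j * Int.gcd t n := by
        rw [ht, ← Int.natCast_dvd_natCast]
        have h1 : (Int.gcd (t * j) n : ℤ) ∣ Int.gcd (j * t) (j * n) :=
          Int.dvd_coe_gcd ((Int.gcd_dvd_left ..).trans (dvd_of_eq (mul_comm _ _)))
            ((Int.gcd_dvd_right ..).mul_left _)
        rwa [Int.gcd_mul_left, Int.natAbs_natCast] at h1
      exact_mod_cast Nat.le_of_dvd (Nat.mul_pos hpos (by exact_mod_cast hg t)) this
    have hs' : (s₀ : ℝ) = s * j := by exact_mod_cast hs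
    have ht' : (t₀ : ℝ) = t * j := by exact_mod_cast ht
    rw [hs', ht', show ((s : ℝ) * j - t * j * ξ) * (s * j - t * j * ξ') =
      j * (j * ((s - t * ξ) * (s - t * ξ'))) by ring, abs_mul, abs_mul (j : ℝ) (_ * _),
      abs_of_pos (by linarith : (0 : ℝ) < j)]
    have e1 := hξ.intCast_sub_mul_ne_zero hst0
    have e2 := hξ'.intCast_sub_mul_ne_zero hst0
    have hy : 0 < |((s : ℝ) - t * ξ) * (s - t * ξ')| := abs_pos.2 (mul_ne_zero e1 e2)
    rw [div_le_div_iff₀ (by positivity) hy]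
    have hd : 0 ≤ |ξ - ξ'| := abs_nonneg _
    calc |ξ - ξ'| * Int.gcd t₀ n * |((s : ℝ) - t * ξ) * (s - t * ξ')|
        ≤ |ξ - ξ'| * (j * (j * Int.gcd t n)) * |((s : ℝ) - t * ξ) * (s - t * ξ')| := by
          gcongr
          refine hgle.trans (le_mul_of_one_le_left ?_ hjR)
          have := hg t
          positivity
      _ = _ := by ring

theorem ENNReal.limsup_mul_of_tendsto_one {α : Type*} {F : Filter α} {u v : α → ℝ≥0∞}
    (hv : Tendsto v F (𝓝 1)) : limsup (u * v) F = limsup u F := by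
  rcases F.eq_or_neBot with rfl | _
  · simp
  · apply le_antisymm
    · have := ENNReal.limsup_mul_le' (u := u) (v := v) (f := F)
        (by simp [hv.limsup_eq]) (by simp [hv.limsup_eq])
      rwa [hv.limsup_eq, mul_one] at this
    · have := ENNReal.le_limsup_mul (u := u) (v := v) (f := F)
      rwa [hv.liminf_eq, mul_one] at this

/-- An open homogeneous condition satisfied at `Ξ` holds near `[Ξ]` in the projective plane. -/
theorem eventually_nhds_mk {p : V3 → Prop} (hp : IsOpen {v | p v})
    (hsmul : ∀ (c : ℝ) (v : V3), c ≠ 0 → p v → p (c • v)) {Ξ : V3} (hΞ : Ξ ≠ 0) (h : p Ξ) :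
    ∀ᶠ x in 𝓝 (Projectivization.mk ℝ Ξ hΞ), ∀ v : V3, ∀ hv : v ≠ 0,
      x = Projectivization.mk ℝ v hv → p v := by
  have key : ∀ (v w : V3) (hv : v ≠ 0) (hw : w ≠ 0),
      Projectivization.mk ℝ v hv = Projectivization.mk ℝ w hw → p v → p w := by
    intro v w hv hw hvw hpv
    obtain ⟨c, hc⟩ := (Projectivization.mk_eq_mk_iff' ℝ w v hw hv).1 hvw.symm
    rw [← hc]
    refine hsmul c v ?_ hpv
    rintro rfl
    exact hw (by rw [← hc, zero_smul])
  have hopen : IsOpen {x : ℙ ℝ V3 | ∀ v : V3, ∀ hv : v ≠ 0,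
      x = Projectivization.mk ℝ v hv → p v} := by
    rw [isOpen_coinduced]
    convert hp.preimage continuous_subtype_val using 1
    ext ⟨w, hw⟩
    exact ⟨fun H => H w hw rfl, fun H v hv hwv => key w v hw hv hwv H⟩
  exact hopen.mem_nhds fun v hv hvx => key Ξ v hΞ hv hvx h

theorem map_ne_zero_of_det_real {a b c d x : ℝ} (hdet : a * d - b * c ≠ 0) :
    a * x + b ≠ 0 ∨ c * x + d ≠ 0 := by
  by_contra! h
  exact hdet (by linear_combination a * h.2 - c * h.1)

theorem Irrational.intCast_mul_add_ne_zero {a b : ℤ} {ξ : ℝ} (hξ : Irrational ξ)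
    (h : a ≠ 0 ∨ b ≠ 0) : (a : ℝ) * ξ + b ≠ 0 := by
  have := hξ.intCast_sub_mul_ne_zero (s := b) (t := -a) (by omega)
  push_cast at this
  intro h0
  exact this (by linear_combination h0)

/-- The parametrization of the conic is continuous as a map to the projective plane. -/
theorem tendsto_mk_conicPt {A B C D : ℤ} {a b c d : ℝ} (ξ : ℝ)
    (hne : ∀ x : ℝ, conicPt A B C D (a * x + b) (c * x + d) ≠ 0) :
    Tendsto (fun x => Projectivization.mk ℝ _ (hne x)) (𝓝 ξ)
      (𝓝 (Projectivization.mk ℝ _ (hne ξ))) := by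
  have h1 : Continuous fun x : ℝ =>
      (⟨conicPt A B C D (a * x + b) (c * x + d), hne x⟩ : {v : V3 // v ≠ 0}) := by
    refine Continuous.subtype_mk ?_ _
    refine continuous_pi fun i => ?_
    fin_cases i <;> simp only [conicPt] <;> simp <;> fun_prop
  have h2 : Continuous (Projectivization.mk' ℝ : {v : V3 // v ≠ 0} → ℙ ℝ V3) :=
    continuous_coinduced_rng
  exact (h2.comp h1).tendsto ξ

/-- The affine parameter of a point near `Ξ` on the conic tends to that of `Ξ`. -/
theorem tendsto_param {Φ : V3 → ℝ} {A B C D a b c d : ℤ} (hD : 1 ≤ D)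
    (hdet : a * d - b * c ≠ 0) {ξ : ℝ} (hS : (a : ℝ) * ξ + b ≠ 0)
    (hΞ : conicPt A B C D (a * ξ + b) (c * ξ + d) ≠ 0) :
    Tendsto (fun P : ConicPts Φ =>
        ((d * P.1 0 - b * P.1 1 : ℤ) : ℚ) / ((a * P.1 1 - c * P.1 0 : ℤ) : ℚ))
      (comap (fun P : ConicPts Φ => Projectivization.mk ℝ (intCast3 P.1) P.2.1)
        (𝓝 (Projectivization.mk ℝ _ hΞ)))
      (comap (fun q : ℚ => (q : ℝ)) (𝓝 ξ)) ∧
    ∀ᶠ P in comap (fun P : ConicPts Φ => Projectivization.mk ℝ (intCast3 P.1) P.2.1)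
        (𝓝 (Projectivization.mk ℝ _ hΞ)), P.1 0 ≠ 0 ∧ a * P.1 1 - c * P.1 0 ≠ 0 := by
  have hD' : (D : ℝ) ≠ 0 := by exact_mod_cast (by omega : D ≠ 0)
  have hdet' : (a : ℝ) * d - b * c ≠ 0 := by exact_mod_cast hdet
  have hM : (a : ℝ) * conicPt A B C D (a * ξ + b) (c * ξ + d) 1 -
      c * conicPt A B C D (a * ξ + b) (c * ξ + d) 0 = D * (a * ξ + b) * (a * d - b * c) := by
    simp [conicPt]; ring
  have hN : (d : ℝ) * conicPt A B C D (a * ξ + b) (c * ξ + d) 0 -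
      b * conicPt A B C D (a * ξ + b) (c * ξ + d) 1 = ξ * (D * (a * ξ + b) * (a * d - b * c)) := by
    simp [conicPt]; ring
  have hMne : (D : ℝ) * (a * ξ + b) * (a * d - b * c) ≠ 0 :=
    mul_ne_zero (mul_ne_zero hD' hS) hdet'
  refine ⟨?_, ?_⟩
  · rw [tendsto_comap_iff, Metric.tendsto_nhds]
    intro ε hε
    refine ((eventually_nhds_mk (Ξ := conicPt A B C D (a * ξ + b) (c * ξ + d))
      (p := fun v => |(d * v 0 - b * v 1) - ξ * (a * v 1 - c * v 0)| < ε * |a * v 1 - c * v 0|)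
      (isOpen_lt (by fun_prop) (by fun_prop)) ?_ hΞ ?_).comap _).mono ?_
    · intro r v hr hv
      have : 0 < |r| := abs_pos.2 hr
      simp only [Pi.smul_apply, smul_eq_mul]
      rw [show (d * (r * v 0) - b * (r * v 1)) - ξ * (a * (r * v 1) - c * (r * v 0)) =
        r * ((d * v 0 - b * v 1) - ξ * (a * v 1 - c * v 0)) by ring,
        show (a * (r * v 1) - c * (r * v 0)) = r * (a * v 1 - c * v 0) by ring, abs_mul, abs_mul,
        mul_left_comm]
      exact mul_lt_mul_of_pos_left hv this
    · rw [hM, hN, sub_self, abs_zero]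
      exact mul_pos hε (abs_pos.2 hMne)
    · intro P hP
      have := hP _ P.2.1 rfl
      simp only [intCast3] at this
      have hpos : 0 < |(a : ℝ) * P.1 1 - c * P.1 0| :=
        pos_of_mul_pos_right ((abs_nonneg _).trans_lt this) hε.le
      simp only [Function.comp, Real.dist_eq]
      push_cast
      rw [div_sub' (abs_pos.1 hpos), abs_div, div_lt_iff₀ hpos]
      rwa [mul_comm _ ξ]
  · refine ((eventually_nhds_mk (Ξ := conicPt A B C D (a * ξ + b) (c * ξ + d))
      (p := fun v => v 0 ≠ 0 ∧ a * v 1 - c * v 0 ≠ 0) ?_ ?_ hΞ ?_).comap _).mono ?_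
    · exact (isOpen_ne_fun (by fun_prop) (by fun_prop)).inter
        (isOpen_ne_fun (by fun_prop) (by fun_prop))
    · rintro r v hr ⟨h0, h1⟩
      refine ⟨mul_ne_zero hr h0, ?_⟩
      simp only [Pi.smul_apply, smul_eq_mul]
      rw [show (a * (r * v 1) - c * (r * v 0)) = r * (a * v 1 - c * v 0) by ring]
      exact mul_ne_zero hr h1
    · refine ⟨?_, hM ▸ hMne⟩
      simp [conicPt, hD', hS]
    · intro P hP
      have := hP _ P.2.1 rfl
      simp only [intCast3] at this
      exact_mod_cast this

theorem lambdaPhi_eq {A B C D a b c d : ℤ} {m n : ℕ} (hC : 1 ≤ C) (hD : 1 ≤ D) (hm : 0 < m)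
    (hn : 0 < n) (hdet : a * d - b * c ≠ 0)
    (hcont : ∀ s t : ℤ, IsCoprime s t →
      vecContent (conicVec A B C D (a * s + b * t) (c * s + d * t)) =
        m * (a * d - b * c).natAbs * Int.gcd t n)
    {ξ : ℝ} (hξ : Irrational ξ) {Sg : V3}
    (h : bil (Phi6 (-A) (-B) (-C) D 0 0) Sg (conicPt A B C D (a * ξ + b) (c * ξ + d)) = 0)
    (hSg : ∀ r : ℝ, Sg ≠ r • conicPt A B C D (a * ξ + b) (c * ξ + d)) :
    lambdaPhi (Phi6 (-A) (-B) (-C) D 0 0) ((C : ℝ) * (D : ℝ) ^ 2)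
      (conicPt A B C D (a * ξ + b) (c * ξ + d)) Sg = (m : ℝ≥0∞) * nLagrange n ξ := by
  have hdet' : ((a * d - b * c : ℤ) : ℝ) ≠ 0 := by exact_mod_cast hdet
  have hdetR : (a : ℝ) * d - b * c ≠ 0 := by exact_mod_cast hdet
  have hS : (a : ℝ) * ξ + b ≠ 0 := hξ.intCast_mul_add_ne_zero (by
    by_contra! hcon
    exact hdet (by rw [hcon.1, hcon.2]; ring))
  have hne : ∀ x : ℝ, conicPt A B C D (a * x + b) (c * x + d) ≠ 0 := fun x =>
    conicPt_ne_zero hC hD (map_ne_zero_of_det_real hdetR)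
  have hmR : (0 : ℝ) < m := by exact_mod_cast hm
  have hg : ∀ t : ℤ, (0 : ℝ) < Int.gcd t n := fun t => by
    exact_mod_cast Int.gcd_pos_of_ne_zero_right t (by exact_mod_cast hn.ne')
  obtain ⟨k, l, hkl, hsqrt⟩ := exists_bil_eq_mul hC hdet h
  have hK0 : k * ξ + l ≠ 0 := by
    intro h0
    rw [h0, abs_zero, zero_div, Real.sqrt_eq_zero'] at hsqrt
    have hCD : (0 : ℝ) < C * (D : ℝ) ^ 2 := by
      have : 0 < C * D ^ 2 := by positivity
      exact_mod_cast this
    have hΦ : Phi6 (-A) (-B) (-C) D 0 0 Sg = 0 := by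
      rw [← abs_eq_zero]
      exact le_antisymm (nonpos_of_mul_nonpos_right hsqrt hCD) (abs_nonneg _)
    obtain ⟨r, hr⟩ := eq_smul_of_bil_eq_zero hC hD hS h hΦ
    exact hSg r hr
  set H : ℚ → ℝ := fun q => m * (|k * ξ + l| * Int.gcd q.den n /
    |((q.num : ℝ) - ξ * q.den) * (k * q.num + l * q.den)|) with hH
  have hval : ∀ (q : ℚ) (x j : ℝ),
      (vecContent (conicVec A B C D (a * q.num + b * q.den) (c * q.num + d * q.den)) : ℝ) * x =
        j * bil (Phi6 (-A) (-B) (-C) D 0 0) Sg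
          (conicPt A B C D ((a * q.num + b * q.den : ℤ) : ℝ) ((c * q.num + d * q.den : ℤ) : ℝ)) →
      Real.sqrt (C * (D : ℝ) ^ 2 * |Phi6 (-A) (-B) (-C) D 0 0 Sg|) / |x| = H q / |j| := by
    intro q x j hx
    rw [hcont _ _ q.isCoprime_num_den] at hx
    push_cast at hx hkl
    rw [hkl] at hx
    rw [hsqrt, div_div_abs_eq (g := Int.gcd q.den n) (k := j)
      (y := ((q.num : ℝ) - ξ * q.den) * (k * q.num + l * q.den)) (abs_pos.2 hdet') hmR (hg _)
      (by
        rw [Nat.cast_natAbs] at hx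
        push_cast at hx ⊢
        rw [hx])]
  have hden : ∀ q : ℚ, q.num ≠ 0 ∨ (q.den : ℤ) ≠ 0 := fun q =>
    Or.inr (by exact_mod_cast q.den_ne_zero)
  have hlim : limsup (fun q => ENNReal.ofReal (H q)) (comap (fun q : ℚ => (q : ℝ)) (𝓝 ξ)) =
      (m : ℝ≥0∞) * nLagrange n ξ := by
    have hF : Tendsto (fun q : ℚ => ENNReal.ofReal (|k * ξ + l| / |k * q + l|))
        (comap (fun q : ℚ => (q : ℝ)) (𝓝 ξ)) (𝓝 1) := by
      have h1 : ContinuousAt (fun x : ℝ => |k * ξ + l| / |k * x + l|) ξ :=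
        ContinuousAt.div (by fun_prop) (by fun_prop) (abs_ne_zero.2 hK0)
      have h2 : Tendsto (fun x : ℝ => |k * ξ + l| / |k * x + l|) (𝓝 ξ) (𝓝 1) := by
        have := h1.tendsto
        rwa [div_self (abs_ne_zero.2 hK0)] at this
      have h3 := ENNReal.tendsto_ofReal (h2.comp (tendsto_comap (f := fun q : ℚ => (q : ℝ))))
      simpa using h3
    refine Eq.trans ?_ (congrArg _ (ENNReal.limsup_mul_of_tendsto_one hF))
    rw [← ENNReal.limsup_const_mul_of_ne_top (ENNReal.natCast_ne_top m)]
    congr 1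
    funext q
    have hq : (q.num : ℝ) = q * q.den := by exact_mod_cast (Rat.mul_den_eq_num q).symm
    simp only [Pi.mul_apply]
    rw [← ENNReal.ofReal_mul (by positivity), ← ENNReal.ofReal_natCast m,
      ← ENNReal.ofReal_mul hmR.le, hH]
    simp only
    rw [hq, show ((q : ℝ) * q.den - ξ * q.den) * (k * (q * q.den) + l * q.den) =
      (q.den : ℝ) ^ 2 * (q - ξ) * (k * q + l) by ring, abs_mul, abs_mul,
      abs_of_nonneg (by positivity : 0 ≤ (q.den : ℝ) ^ 2), div_mul_div_comm, Int.gcd_natCast_natCast,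
      mul_comm |k * ξ + l|]
  rw [lambdaPhi, dif_pos (hne ξ), ← hlim]
  obtain ⟨hρ, hρ'⟩ := tendsto_param (Φ := Phi6 (-A) (-B) (-C) D 0 0) (A := A) (B := B) (C := C)
    hD hdet hS (hne ξ)
  apply le_antisymm
  · refine (limsup_le_limsup ?_).trans hρ.limsup_comp_le_limsup
    filter_upwards [hρ'] with P hP
    set q : ℚ := ((d * P.1 0 - b * P.1 1 : ℤ) : ℚ) / ((a * P.1 1 - c * P.1 0 : ℤ) : ℚ) with hq
    have hqM : q.num * (a * P.1 1 - c * P.1 0) = (d * P.1 0 - b * P.1 1) * q.den := by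
      have h1 : ((a * P.1 1 - c * P.1 0 : ℤ) : ℚ) ≠ 0 := by exact_mod_cast hP.2
      have h2 := Rat.mul_den_eq_num q
      rw [eq_div_iff h1] at hq
      have : (q.num : ℚ) * ((a * P.1 1 - c * P.1 0 : ℤ) : ℚ) =
          ((d * P.1 0 - b * P.1 1 : ℤ) : ℚ) * q.den := by
        rw [← h2, ← hq]; ring
      exact_mod_cast this
    obtain ⟨j, hj, hj'⟩ := exists_mul_bil_eq hC hD (map_ne_zero_of_det hdet (hden q)) P.2.1
      (proportional_conicVec P.2.2 hP.1 (by linear_combination hqM)) Sg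
    rw [hval q _ j hj']
    have hj1 : (1 : ℝ) ≤ |(j : ℝ)| := by exact_mod_cast Int.one_le_abs hj
    exact ENNReal.ofReal_le_ofReal (div_le_self (by positivity) hj1)
  · choose θ hθ using fun q : ℚ => exists_smul_intCast3_eq (A := A) (B := B) hC hD
      (map_ne_zero_of_det hdet (hden q))
    have hθL : Tendsto θ (comap (fun q : ℚ => (q : ℝ)) (𝓝 ξ))
        (comap (fun P : ConicPts (Phi6 (-A) (-B) (-C) D 0 0) =>
          Projectivization.mk ℝ (intCast3 P.1) P.2.1) (𝓝 (Projectivization.mk ℝ _ (hne ξ)))) := by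
      rw [tendsto_comap_iff]
      refine ((tendsto_mk_conicPt ξ hne).comp tendsto_comap).congr fun q => ?_
      simp only [Function.comp]
      rw [Projectivization.mk_eq_mk_iff']
      have hq : (q.num : ℝ) = q * q.den := by exact_mod_cast (Rat.mul_den_eq_num q).symm
      have hd0 : (q.den : ℝ) ≠ 0 := by exact_mod_cast q.den_ne_zero
      have hs : conicPt A B C D ((a * q.num + b * q.den : ℤ) : ℝ)
          ((c * q.num + d * q.den : ℤ) : ℝ) =
            (q.den : ℝ) ^ 2 • conicPt A B C D (a * q + b) (c * q + d) := by
        push_cast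
        rw [hq]
        funext i
        fin_cases i <;> simp [conicPt] <;> ring
      refine ⟨vecContent (conicVec A B C D (a * q.num + b * q.den) (c * q.num + d * q.den)) /
        (q.den : ℝ) ^ 2, ?_⟩
      rw [div_eq_inv_mul, mul_smul, ← hθ, hs, smul_smul, inv_mul_cancel₀ (pow_ne_zero 2 hd0),
        one_smul]
    refine le_of_eq_of_le ?_ hθL.limsup_comp_le_limsup
    congr 1
    funext q
    simp only [Function.comp]
    rw [hval q _ 1 (by rw [hθ, bil_smul_right, one_mul]), abs_one, div_one]

/-- Main theorem, Theorem 1.1: for the conic `Φ_{A,B,C,D} = 0` there are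
positive integers `m, n` with `m·n ∣ C·D²` and a rational reparametrization `g` of the conic
such that the Lagrange and Markoff approximabilities are `m` times the `n`-Lagrange and
`n`-Markoff approximabilities of the corresponding parameters. -/
theorem stmt0 (A B C D : ℤ) (hC : 1 ≤ C) (hD : 1 ≤ D) :
    ∃ m n : ℕ, 0 < m ∧ 0 < n ∧ ((m : ℤ) * (n : ℤ)) ∣ C * D ^ 2 ∧
      ∃ g : Matrix (Fin 2) (Fin 2) ℚ, IsUnit g ∧
        ∀ ξ ξ' : ℝ, Irrational ξ → Irrational ξ' → ξ ≠ ξ' →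
          let Φ := Phi6 (-A) (-B) (-C) D 0 0
          let gR := g.map (fun x : ℚ => (x : ℝ))
          let S := gR.mulVec ![ξ, 1] 0
          let T := gR.mulVec ![ξ, 1] 1
          let S' := gR.mulVec ![ξ', 1] 0
          let T' := gR.mulVec ![ξ', 1] 1
          let Ξ : V3 := ![(D : ℝ) * S ^ 2, (D : ℝ) * S * T,
            (A : ℝ) * S ^ 2 + (B : ℝ) * S * T + (C : ℝ) * T ^ 2]
          let Ξ' : V3 := ![(D : ℝ) * S' ^ 2, (D : ℝ) * S' * T',
            (A : ℝ) * S' ^ 2 + (B : ℝ) * S' * T' + (C : ℝ) * T' ^ 2]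
          (∀ Sg : V3, bil Φ Sg Ξ = 0 → (∀ c : ℝ, Sg ≠ c • Ξ) →
            lambdaPhi Φ ((C : ℝ) * (D : ℝ) ^ 2) Ξ Sg = (m : ℝ≥0∞) * nLagrange n ξ) ∧
          (∀ Sg : V3, Sg ≠ 0 → bil Φ Sg Ξ = 0 → bil Φ Sg Ξ' = 0 →
            muPhi Φ ((C : ℝ) * (D : ℝ) ^ 2) Sg = (m : ℝ≥0∞) * nMarkoff n ξ ξ') := by
  obtain ⟨m, n, hm, hn, hmn, a, b, c, d, hdet, hcont⟩ := exists_reparametrization A B C D hC hD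
  refine ⟨m, n, hm, hn, hmn, !![(a : ℚ), b; c, d], ?_, ?_⟩
  · rw [Matrix.isUnit_iff_isUnit_det, Matrix.det_fin_two_of, isUnit_iff_ne_zero]
    exact_mod_cast hdet
  · intro ξ ξ' hξ hξ' hne Φ gR S T S' T' Ξ Ξ'
    have hS : S = a * ξ + b := by simp [S, gR]
    have hT : T = c * ξ + d := by simp [T, gR]
    have hS' : S' = a * ξ' + b := by simp [S', gR]
    have hT' : T' = c * ξ' + d := by simp [T', gR]
    have hΞ : Ξ = conicPt A B C D (a * ξ + b) (c * ξ + d) := by rw [← hS, ← hT]; rfl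
    have hΞ' : Ξ' = conicPt A B C D (a * ξ' + b) (c * ξ' + d) := by rw [← hS', ← hT']; rfl
    rw [hΞ, hΞ']
    exact ⟨fun Sg h hSg => lambdaPhi_eq hC hD hm hn hdet hcont hξ h hSg,
      fun Sg hSg h h' => muPhi_eq hC hD hm hn hdet hcont hξ hξ' hne hSg h h'⟩

end
end

section
/- Let Φ be a ternary quadratic form with integer coefficients and discriminant Δ_Φ > 0, and let U ∈ SL₃(ℤ) satisfy Φ(U·x) = Φ(x) for all x ∈ ℝ³. Let Ξ ∈ ℝ³ be nonzero with Φ(Ξ) = 0 and spanning an irrational line. Then for every Σ ∈ ℝ³ with ⟨Σ,Ξ⟩_Φ = 0 and Σ not a real scalar multiple of Ξ, and every Σ' ∈ ℝ³ with ⟨Σ',U·Ξ⟩_Φ = 0 and Σ' not a real scalar multiple of U·Ξ, one has λ_Φ(Ξ;Σ) = λ_Φ(U·Ξ;Σ'). -/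
noncomputable section
open Filter Topology
open scoped ENNReal LinearAlgebra.Projectivization

section LagrangeInvariance

variable {A B C D E F : ℤ}

lemma bil_Phi6 (P Q : V3) : bil (Phi6 A B C D E F) P Q =
    A * (P 0 * Q 0) + B * (P 0 * Q 1 + P 1 * Q 0) / 2 + C * (P 1 * Q 1)
      + D * (P 0 * Q 2 + P 2 * Q 0) / 2 + E * (P 1 * Q 2 + P 2 * Q 1) / 2 + F * (P 2 * Q 2) := by
  simp only [bil, Phi6, Pi.add_apply]
  ring

lemma bil_Phi6_comm (P Q : V3) :
    bil (Phi6 A B C D E F) P Q = bil (Phi6 A B C D E F) Q P := by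
  simp only [bil_Phi6]
  ring

lemma continuous_bil_Phi6 (P : V3) : Continuous (bil (Phi6 A B C D E F) P) := by
  have h : bil (Phi6 A B C D E F) P = fun Q => _ := funext (bil_Phi6 P)
  rw [h]
  fun_prop

lemma bil_Phi6_combination_left (a b c : ℝ) (P Q R S : V3) :
    bil (Phi6 A B C D E F) (a • P + b • Q + c • R) S =
      a * bil (Phi6 A B C D E F) P S + b * bil (Phi6 A B C D E F) Q S
        + c * bil (Phi6 A B C D E F) R S := by
  simp only [bil_Phi6, Pi.add_apply, Pi.smul_apply, smul_eq_mul]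
  ring

lemma Phi6_combination (a b c : ℝ) (P Q R : V3) :
    Phi6 A B C D E F (a • P + b • Q + c • R) =
      a ^ 2 * Phi6 A B C D E F P + b ^ 2 * Phi6 A B C D E F Q + c ^ 2 * Phi6 A B C D E F R
        + 2 * (a * b * bil (Phi6 A B C D E F) P Q + a * c * bil (Phi6 A B C D E F) P R
          + b * c * bil (Phi6 A B C D E F) Q R) := by
  simp only [bil_Phi6, Phi6, Pi.add_apply, Pi.smul_apply, smul_eq_mul]
  ring

/-- The determinant of three vectors of `ℝ³`. -/
def det3 (P Q R : V3) : ℝ :=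
  P 0 * (Q 1 * R 2 - Q 2 * R 1) - P 1 * (Q 0 * R 2 - Q 2 * R 0) + P 2 * (Q 0 * R 1 - Q 1 * R 0)

lemma det3_smul_eq (P Q R S : V3) :
    det3 P Q R • S = det3 S Q R • P + det3 P S R • Q + det3 P Q S • R := by
  ext i
  fin_cases i <;> simp [det3] <;> ring

/-- The Gram determinant of three vectors is `Δ / 4` times the square of their determinant. -/
lemma disc6_mul_det3_sq (P Q R : V3) :
    (disc6 A B C D E F : ℝ) * det3 P Q R ^ 2 =
      4 * (Phi6 A B C D E F P * Phi6 A B C D E F Q * Phi6 A B C D E F R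
        + 2 * bil (Phi6 A B C D E F) P Q * bil (Phi6 A B C D E F) P R *
            bil (Phi6 A B C D E F) Q R
        - Phi6 A B C D E F P * bil (Phi6 A B C D E F) Q R ^ 2
        - Phi6 A B C D E F Q * bil (Phi6 A B C D E F) P R ^ 2
        - Phi6 A B C D E F R * bil (Phi6 A B C D E F) P Q ^ 2) := by
  simp only [bil_Phi6, Phi6, det3, disc6]
  push_cast
  ring

lemma exists_det3_ne_zero {P Q : V3} (hP : P ≠ 0) (hQ : ∀ c : ℝ, Q ≠ c • P) :
    ∃ R, det3 P Q R ≠ 0 := by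
  by_contra! h
  have h0 := h ![1, 0, 0]
  have h1 := h ![0, 1, 0]
  have h2 := h ![0, 0, 1]
  simp [det3] at h0 h1 h2
  obtain ⟨i, hi⟩ := Function.ne_iff.mp hP
  apply hQ (Q i / P i)
  ext j
  simp only [Pi.zero_apply] at hi
  simp only [Pi.smul_apply, smul_eq_mul]
  field_simp
  fin_cases i <;> fin_cases j <;> simp <;> linarith

/-- An isotropic vector together with a vector orthogonal and not proportional to it extends to a
basis of `ℝ³` by an isotropic vector dual to the first and orthogonal to the second. -/
lemma exists_isotropic_frame (hdisc : 0 < disc6 A B C D E F) {Ξ S : V3} (hΞ : Ξ ≠ 0)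
    (hzero : Phi6 A B C D E F Ξ = 0) (h1 : bil (Phi6 A B C D E F) S Ξ = 0)
    (h2 : ∀ c : ℝ, S ≠ c • Ξ) :
    Phi6 A B C D E F S ≠ 0 ∧ ∃ H : V3, bil (Phi6 A B C D E F) H Ξ = 1 ∧
      bil (Phi6 A B C D E F) S H = 0 ∧ Phi6 A B C D E F H = 0 ∧
      ∀ P, P = bil (Phi6 A B C D E F) H P • Ξ
        + (bil (Phi6 A B C D E F) S P / Phi6 A B C D E F S) • S
        + bil (Phi6 A B C D E F) Ξ P • H := by
  have hΔ : (disc6 A B C D E F : ℝ) ≠ 0 := by exact_mod_cast hdisc.ne'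
  have h1s : bil (Phi6 A B C D E F) Ξ S = 0 := by rw [bil_Phi6_comm]; exact h1
  have gram (W : V3) : (disc6 A B C D E F : ℝ) * det3 Ξ S W ^ 2 =
      -4 * Phi6 A B C D E F S * bil (Phi6 A B C D E F) Ξ W ^ 2 := by
    rw [disc6_mul_det3_sq, hzero, h1s]; ring
  obtain ⟨W, hW⟩ := exists_det3_ne_zero hΞ h2
  have hne : (disc6 A B C D E F : ℝ) * det3 Ξ S W ^ 2 ≠ 0 := mul_ne_zero hΔ (pow_ne_zero 2 hW)
  rw [gram] at hne
  have hs : Phi6 A B C D E F S ≠ 0 := by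
    intro h; simp [h] at hne
  have hx : bil (Phi6 A B C D E F) Ξ W ≠ 0 := by
    intro h; simp [h] at hne
  refine ⟨hs, ?_⟩
  have hbilself (P : V3) : bil (Phi6 A B C D E F) P P = Phi6 A B C D E F P := by
    simp only [bil_Phi6, Phi6]; ring
  obtain ⟨x, hxe⟩ : ∃ x, x = bil (Phi6 A B C D E F) Ξ W := ⟨_, rfl⟩
  obtain ⟨t, hte⟩ : ∃ t, t = bil (Phi6 A B C D E F) S W := ⟨_, rfl⟩
  obtain ⟨s, hse⟩ : ∃ s, s = Phi6 A B C D E F S := ⟨_, rfl⟩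
  obtain ⟨w, hwe⟩ : ∃ w, w = Phi6 A B C D E F W := ⟨_, rfl⟩
  rw [← hse] at hs
  rw [← hxe] at hx
  obtain ⟨H, hH⟩ : ∃ H : V3,
      H = (t ^ 2 / (2 * x ^ 2 * s) - w / (2 * x ^ 2)) • Ξ + (-t / (x * s)) • S + (1 / x) • W :=
    ⟨_, rfl⟩
  have hHΞ : bil (Phi6 A B C D E F) H Ξ = 1 := by
    rw [hH, bil_Phi6_combination_left, hbilself, hzero, h1, bil_Phi6_comm W, ← hxe]
    field_simp; ring
  have hSH : bil (Phi6 A B C D E F) S H = 0 := by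
    rw [bil_Phi6_comm, hH, bil_Phi6_combination_left, hbilself, h1s, bil_Phi6_comm W, ← hte, ← hse]
    field_simp; ring
  have hHH : Phi6 A B C D E F H = 0 := by
    rw [hH, Phi6_combination, hzero, h1s, ← hxe, ← hte, ← hse, ← hwe]
    field_simp; ring
  have hd : det3 Ξ S H ≠ 0 := by
    intro h
    have := gram H
    rw [h, bil_Phi6_comm, hHΞ, ← hse] at this
    apply hs
    linarith
  refine ⟨H, hHΞ, hSH, hHH, fun P => ?_⟩
  obtain ⟨a, b, c, rfl⟩ : ∃ a b c : ℝ, P = a • Ξ + b • S + c • H := by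
    refine ⟨det3 P S H / det3 Ξ S H, det3 Ξ P H / det3 Ξ S H, det3 Ξ S P / det3 Ξ S H, ?_⟩
    have := congrArg ((det3 Ξ S H)⁻¹ • ·) (det3_smul_eq Ξ S H P)
    simpa only [smul_add, smul_smul, inv_mul_cancel₀ hd, one_smul, div_eq_inv_mul] using this
  rw [bil_Phi6_comm H, bil_Phi6_comm S, bil_Phi6_comm Ξ (_ + _)]
  simp only [bil_Phi6_combination_left, hbilself, hzero, h1, h1s, hHΞ, hSH, hHH,
    bil_Phi6_comm Ξ H, bil_Phi6_comm H S, ← hse]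
  simp [hs]

/-- The neighbourhood filter of `[Ξ]`, pulled back to the nonzero integer points of the conic. -/
def conicNhds (Φ : V3 → ℝ) (Ξ : V3) (hΞ : Ξ ≠ 0) : Filter (ConicPts Φ) :=
  Filter.comap (fun P : ConicPts Φ => Projectivization.mk ℝ (intCast3 P.1) P.2.1)
    (nhds (Projectivization.mk ℝ Ξ hΞ))

lemma lambdaPhi_of_ne_zero (Φ : V3 → ℝ) (Δ : ℝ) {Ξ : V3} (hΞ : Ξ ≠ 0) (S : V3) :
    lambdaPhi Φ Δ Ξ S = Filter.limsup (fun P : ConicPts Φ =>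
      ENNReal.ofReal (Real.sqrt (Δ * |Φ S|) / |bil Φ S (intCast3 P.1)|)) (conicNhds Φ Ξ hΞ) :=
  dif_pos hΞ

/-- An open condition on `ℝ³` that is invariant under scaling and holds at `Ξ` holds near `[Ξ]`. -/
lemma eventually_conicNhds {Φ : V3 → ℝ} {Ξ : V3} (hΞ : Ξ ≠ 0) {p : V3 → Prop}
    (hopen : IsOpen {v | p v}) (hscale : ∀ (v : V3) (c : ℝ), c ≠ 0 → p v → p (c • v))
    (hp : p Ξ) : ∀ᶠ P in conicNhds Φ Ξ hΞ, p (intCast3 P.1) := by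
  have hrep (v : V3) (hv : v ≠ 0) : p (Projectivization.mk ℝ v hv).rep ↔ p v := by
    obtain ⟨a, ha⟩ := Projectivization.exists_smul_eq_mk_rep ℝ v hv
    rw [← ha]
    refine ⟨fun h => ?_, hscale v a a.ne_zero⟩
    have := hscale _ ((a : ℝ)⁻¹) (inv_ne_zero a.ne_zero) h
    rwa [Units.smul_def, smul_smul, inv_mul_cancel₀ a.ne_zero, one_smul] at this
  have hset : IsOpen {q : ℙ ℝ V3 | p q.rep} := by
    rw [isOpen_coinduced]
    convert hopen.preimage continuous_subtype_val using 1
    ext v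
    exact hrep v.1 v.2
  have := (hset.mem_nhds (show p (Projectivization.mk ℝ Ξ hΞ).rep from (hrep Ξ hΞ).2 hp))
  filter_upwards [Filter.preimage_mem_comap this] with P hP
  exact (hrep _ _).1 hP

/-- Near `[Ξ]` on the conic, `⟨Ξ, P⟩` is negligible compared with `⟨S, P⟩`. -/
lemma eventually_abs_bil_le (hdisc : 0 < disc6 A B C D E F) {Ξ S : V3} (hΞ : Ξ ≠ 0)
    (hzero : Phi6 A B C D E F Ξ = 0) (hirr : IrrationalLine Ξ)
    (h1 : bil (Phi6 A B C D E F) S Ξ = 0) (h2 : ∀ c : ℝ, S ≠ c • Ξ) {ε : ℝ} (hε : 0 < ε) :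
    ∀ᶠ P in conicNhds (Phi6 A B C D E F) Ξ hΞ,
      bil (Phi6 A B C D E F) S (intCast3 P.1) ≠ 0 ∧
      |bil (Phi6 A B C D E F) Ξ (intCast3 P.1)| ≤
        ε * |bil (Phi6 A B C D E F) S (intCast3 P.1)| := by
  obtain ⟨hs, H, hHΞ, hSH, hHH, hdec⟩ := exists_isotropic_frame hdisc hΞ hzero h1 h2
  have hs' : 0 < |Phi6 A B C D E F S| := abs_pos.2 hs
  have hbilsmul (Q v : V3) (c : ℝ) :
      bil (Phi6 A B C D E F) Q (c • v) = c * bil (Phi6 A B C D E F) Q v := by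
    simp only [bil_Phi6, Pi.smul_apply, smul_eq_mul]; ring
  have key := eventually_conicNhds (Φ := Phi6 A B C D E F) hΞ
    (p := fun v => |bil (Phi6 A B C D E F) S v| <
      2 * |Phi6 A B C D E F S| * ε * |bil (Phi6 A B C D E F) H v|)
    (isOpen_lt (continuous_bil_Phi6 S).abs (continuous_const.mul (continuous_bil_Phi6 H).abs))
    (fun v c hc h => by
      simp only [hbilsmul, abs_mul]
      have := mul_lt_mul_of_pos_left h (abs_pos.2 hc)
      linarith)
    (by simp only [h1, hHΞ, abs_zero, abs_one]; positivity)
  filter_upwards [key] with P hP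
  have hP0 := P.2.2
  have hPdec := hdec (intCast3 P.1)
  rw [hPdec, Phi6_combination, hzero, hHH, hSH, bil_Phi6_comm Ξ S, h1, bil_Phi6_comm Ξ H,
    hHΞ] at hP0
  set a := bil (Phi6 A B C D E F) H (intCast3 P.1)
  set t := bil (Phi6 A B C D E F) S (intCast3 P.1)
  set x := bil (Phi6 A B C D E F) Ξ (intCast3 P.1)
  set s := Phi6 A B C D E F S
  have ha : a ≠ 0 := by
    intro h
    rw [h] at hP
    simp only [abs_zero, mul_zero] at hP
    exact absurd hP (not_lt.2 (abs_nonneg _))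
  have hrel : t ^ 2 = -(2 * s * a * x) := by
    field_simp at hP0
    linarith
  constructor
  · intro ht
    have hx : x = 0 := by
      rw [ht] at hrel
      have : s * a * x = 0 := by linarith
      simpa [hs, ha] using this
    rw [ht, hx] at hPdec
    refine hirr P.1 ?_ a (by simpa using hPdec)
    rintro h
    exact P.2.1 (by ext i; simp [intCast3, h])
  · have habs : |t| * |t| = 2 * |s| * |a| * |x| := by
      rw [← abs_mul, ← pow_two, hrel, abs_neg, abs_mul, abs_mul, abs_mul, abs_two]
    have hle : (2 * |s| * |a|) * |x| ≤ (2 * |s| * |a|) * (ε * |t|) := by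
      rw [← habs]
      have := mul_le_mul_of_nonneg_right hP.le (abs_nonneg t)
      linarith
    exact le_of_mul_le_mul_left hle (by have := abs_pos.2 ha; positivity)

lemma lambdaPhi_le_of_orthogonal (hdisc : 0 < disc6 A B C D E F) {Ξ S S' : V3} (hΞ : Ξ ≠ 0)
    (hzero : Phi6 A B C D E F Ξ = 0) (hirr : IrrationalLine Ξ)
    (h1 : bil (Phi6 A B C D E F) S Ξ = 0) (h2 : ∀ c : ℝ, S ≠ c • Ξ)
    (h1' : bil (Phi6 A B C D E F) S' Ξ = 0) (h2' : ∀ c : ℝ, S' ≠ c • Ξ) (Δ : ℝ) :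
    lambdaPhi (Phi6 A B C D E F) Δ Ξ S' ≤ lambdaPhi (Phi6 A B C D E F) Δ Ξ S := by
  obtain ⟨-, H, -, -, -, hdec⟩ := exists_isotropic_frame hdisc hΞ hzero h1 h2
  obtain ⟨a, b, rfl⟩ : ∃ a b : ℝ, S' = a • Ξ + b • S + (0 : ℝ) • H := by
    have h := hdec S'
    rw [bil_Phi6_comm Ξ S', h1'] at h
    exact ⟨_, _, h⟩
  have hb : b ≠ 0 := by
    rintro rfl
    exact h2' a (by simp)
  have hb' : 0 < |b| := abs_pos.2 hb
  have hΦ : Phi6 A B C D E F (a • Ξ + b • S + (0 : ℝ) • H) = b ^ 2 * Phi6 A B C D E F S := by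
    rw [Phi6_combination, hzero, bil_Phi6_comm Ξ S, h1]; ring
  have hsqrt : √(Δ * |Phi6 A B C D E F (a • Ξ + b • S + (0 : ℝ) • H)|) =
      |b| * √(Δ * |Phi6 A B C D E F S|) := by
    rw [hΦ, abs_mul, abs_pow, mul_left_comm, Real.sqrt_mul (by positivity),
      Real.sqrt_sq (abs_nonneg b)]
  have hk (k : ℝ) (hk : 1 < k) : lambdaPhi (Phi6 A B C D E F) Δ Ξ (a • Ξ + b • S + (0 : ℝ) • H) ≤
      ENNReal.ofReal k * lambdaPhi (Phi6 A B C D E F) Δ Ξ S := by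
    have hk0 : 0 < k := by linarith
    have hk1 : 0 < 1 - 1 / k := by
      rw [sub_pos, div_lt_one hk0]; exact hk
    rw [lambdaPhi_of_ne_zero _ _ hΞ, lambdaPhi_of_ne_zero _ _ hΞ,
      ← ENNReal.limsup_const_mul_of_ne_top ENNReal.ofReal_ne_top]
    refine Filter.limsup_le_limsup ?_
    have hε : 0 < |b| * (1 - 1 / k) / (|a| + 1) := by positivity
    filter_upwards [eventually_abs_bil_le hdisc hΞ hzero hirr h1 h2 hε] with P ⟨ht, hx⟩
    rw [← ENNReal.ofReal_mul hk0.le]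
    apply ENNReal.ofReal_le_ofReal
    rw [hsqrt, bil_Phi6_combination_left, zero_mul, add_zero]
    set t := bil (Phi6 A B C D E F) S (intCast3 P.1)
    set x := bil (Phi6 A B C D E F) Ξ (intCast3 P.1)
    have ht' : 0 < |t| := abs_pos.2 ht
    have hax : |a * x| ≤ |b| * (1 - 1 / k) * |t| := by
      rw [abs_mul]
      calc |a| * |x| ≤ (|a| + 1) * |x| := by gcongr; linarith
        _ ≤ (|a| + 1) * (|b| * (1 - 1 / k) / (|a| + 1) * |t|) := by gcongr
        _ = |b| * (1 - 1 / k) * |t| := by field_simp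
    have hlow : |b| * |t| / k ≤ |a * x + b * t| := by
      have h := abs_sub_abs_le_abs_sub (b * t) (-(a * x))
      rw [abs_neg, sub_neg_eq_add, add_comm (b * t), abs_mul b t] at h
      have : |b| * (1 - 1 / k) * |t| = |b| * |t| - |b| * |t| / k := by ring
      linarith
    have hpos : 0 < |b| * |t| / k := by positivity
    calc |b| * √(Δ * |Phi6 A B C D E F S|) / |a * x + b * t|
        ≤ |b| * √(Δ * |Phi6 A B C D E F S|) / (|b| * |t| / k) := by gcongr
      _ = k * (√(Δ * |Phi6 A B C D E F S|) / |t|) := by field_simp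
  have hlim : Filter.Tendsto
      (fun k : ℝ => ENNReal.ofReal k * lambdaPhi (Phi6 A B C D E F) Δ Ξ S) (𝓝[>] 1)
      (𝓝 (ENNReal.ofReal 1 * lambdaPhi (Phi6 A B C D E F) Δ Ξ S)) :=
    ENNReal.Tendsto.mul_const
      ((ENNReal.continuous_ofReal.tendsto 1).mono_left nhdsWithin_le_nhds) (Or.inl (by simp))
  rw [ENNReal.ofReal_one, one_mul] at hlim
  exact ge_of_tendsto hlim (by filter_upwards [self_mem_nhdsWithin] with k h using hk k h)

/-- The action of an integer matrix of determinant one on `ℝ³`. -/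
def slAct (U : Matrix.SpecialLinearGroup (Fin 3) ℤ) : V3 →ₗ[ℝ] V3 :=
  Matrix.mulVecLin ((U : Matrix (Fin 3) (Fin 3) ℤ).map (Int.cast : ℤ → ℝ))

lemma slAct_inv_apply (U : Matrix.SpecialLinearGroup (Fin 3) ℤ) (x : V3) :
    slAct U (slAct U⁻¹ x) = x := by
  have h : (U : Matrix (Fin 3) (Fin 3) ℤ).map (Int.castRingHom ℝ) *
      ((U⁻¹ : Matrix.SpecialLinearGroup (Fin 3) ℤ) : Matrix (Fin 3) (Fin 3) ℤ).map
        (Int.castRingHom ℝ) = 1 := by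
    rw [← Matrix.map_mul, ← Matrix.SpecialLinearGroup.coe_mul, mul_inv_cancel]
    simp
  simp only [slAct, Matrix.mulVecLin_apply, Matrix.mulVec_mulVec]
  change (_ * _ : Matrix (Fin 3) (Fin 3) ℝ).mulVec x = x
  exact (congrArg (Matrix.mulVec · x) h).trans (Matrix.one_mulVec x)

lemma slAct_apply_inv (U : Matrix.SpecialLinearGroup (Fin 3) ℤ) (x : V3) :
    slAct U⁻¹ (slAct U x) = x := by
  simpa using slAct_inv_apply U⁻¹ x

lemma slAct_injective (U : Matrix.SpecialLinearGroup (Fin 3) ℤ) :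
    Function.Injective (slAct U) :=
  Function.LeftInverse.injective (slAct_apply_inv U)

lemma slAct_ne_zero (U : Matrix.SpecialLinearGroup (Fin 3) ℤ) {x : V3} (hx : x ≠ 0) :
    slAct U x ≠ 0 :=
  (map_ne_zero_iff _ (slAct_injective U)).2 hx

lemma intCast3_mulVec (U : Matrix.SpecialLinearGroup (Fin 3) ℤ) (P : Fin 3 → ℤ) :
    intCast3 ((U : Matrix (Fin 3) (Fin 3) ℤ).mulVec P) = slAct U (intCast3 P) := by
  ext i
  simp [intCast3, slAct, Matrix.mulVec, dotProduct]

lemma bil_slAct {Φ : V3 → ℝ} {U : Matrix.SpecialLinearGroup (Fin 3) ℤ}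
    (hU : ∀ x, Φ (slAct U x) = Φ x) (P Q : V3) :
    bil Φ (slAct U P) (slAct U Q) = bil Φ P Q := by
  simp only [bil, ← map_add, hU]

lemma continuous_projectivization_map (U : Matrix.SpecialLinearGroup (Fin 3) ℤ) :
    Continuous (Projectivization.map (slAct U) (slAct_injective U)) := by
  rw [continuous_coinduced_dom]
  have hc : Continuous (fun v : {v : V3 // v ≠ 0} =>
      (⟨slAct U v.1, slAct_ne_zero U v.2⟩ : {v : V3 // v ≠ 0})) :=
    ((slAct U).continuous_of_finiteDimensional.comp continuous_subtype_val).subtype_mk _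
  exact (continuous_coinduced_rng (f := Projectivization.mk' ℝ)).comp hc

lemma lambdaPhi_le_slAct {Φ : V3 → ℝ} {U : Matrix.SpecialLinearGroup (Fin 3) ℤ}
    (hU : ∀ x, Φ (slAct U x) = Φ x) (Δ : ℝ) {Ξ : V3} (hΞ : Ξ ≠ 0) (S : V3) :
    lambdaPhi Φ Δ Ξ S ≤ lambdaPhi Φ Δ (slAct U Ξ) (slAct U S) := by
  rw [lambdaPhi_of_ne_zero _ _ hΞ, lambdaPhi_of_ne_zero _ _ (slAct_ne_zero U hΞ)]
  let e : ConicPts Φ → ConicPts Φ := fun P =>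
    ⟨(U : Matrix (Fin 3) (Fin 3) ℤ).mulVec P.1, by
      rw [intCast3_mulVec, hU]
      exact ⟨slAct_ne_zero U P.2.1, P.2.2⟩⟩
  have he : Filter.Tendsto e (conicNhds Φ Ξ hΞ)
      (conicNhds Φ (slAct U Ξ) (slAct_ne_zero U hΞ)) := by
    refine Filter.tendsto_comap_iff.2 ?_
    have h := ((continuous_projectivization_map U).tendsto (Projectivization.mk ℝ Ξ hΞ)).comp
      (Filter.tendsto_comap (f := fun P : ConicPts Φ =>
        Projectivization.mk ℝ (intCast3 P.1) P.2.1))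
    rw [Projectivization.map_mk] at h
    refine h.congr fun P => ?_
    change Projectivization.map _ _ (Projectivization.mk ℝ _ _) =
      Projectivization.mk ℝ (intCast3 ((U : Matrix (Fin 3) (Fin 3) ℤ).mulVec P.1)) _
    simp only [Projectivization.map_mk, intCast3_mulVec]
  refine le_trans (le_of_eq ?_) (Filter.limsup_le_limsup_of_le he)
  rw [← Filter.limsup_comp]
  congr 1
  ext P
  change _ = ENNReal.ofReal (_ / |bil Φ (slAct U S)
    (intCast3 ((U : Matrix (Fin 3) (Fin 3) ℤ).mulVec P.1))|)
  rw [intCast3_mulVec, bil_slAct hU, hU]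

lemma lambdaPhi_slAct {Φ : V3 → ℝ} {U : Matrix.SpecialLinearGroup (Fin 3) ℤ}
    (hU : ∀ x, Φ (slAct U x) = Φ x) (Δ : ℝ) {Ξ : V3} (hΞ : Ξ ≠ 0) (S : V3) :
    lambdaPhi Φ Δ (slAct U Ξ) (slAct U S) = lambdaPhi Φ Δ Ξ S := by
  refine le_antisymm ?_ (lambdaPhi_le_slAct hU Δ hΞ S)
  have hU' (x : V3) : Φ (slAct U⁻¹ x) = Φ x := by
    rw [← hU, slAct_inv_apply]
  simpa only [slAct_apply_inv] using
    lambdaPhi_le_slAct hU' Δ (slAct_ne_zero U hΞ) (slAct U S)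

end LagrangeInvariance

/-- the Lagrange approximability is invariant under an `SL₃(ℤ)`-symmetry
of the form `Φ`. -/
theorem stmt1 (A B C D E F : ℤ) (hdisc : 0 < disc6 A B C D E F)
    (U : Matrix.SpecialLinearGroup (Fin 3) ℤ)
    (hU : ∀ x : V3,
      Phi6 A B C D E F (((U : Matrix (Fin 3) (Fin 3) ℤ).map (Int.cast : ℤ → ℝ)).mulVec x) =
        Phi6 A B C D E F x)
    (Ξ : V3) (hΞ : Ξ ≠ 0) (hzero : Phi6 A B C D E F Ξ = 0) (hirr : IrrationalLine Ξ)
    (Sg Sg' : V3)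
    (h1 : bil (Phi6 A B C D E F) Sg Ξ = 0) (h2 : ∀ c : ℝ, Sg ≠ c • Ξ)
    (h1' : bil (Phi6 A B C D E F) Sg'
      (((U : Matrix (Fin 3) (Fin 3) ℤ).map (Int.cast : ℤ → ℝ)).mulVec Ξ) = 0)
    (h2' : ∀ c : ℝ, Sg' ≠
      c • (((U : Matrix (Fin 3) (Fin 3) ℤ).map (Int.cast : ℤ → ℝ)).mulVec Ξ)) :
    lambdaPhi (Phi6 A B C D E F) ((disc6 A B C D E F : ℝ)) Ξ Sg =
      lambdaPhi (Phi6 A B C D E F) ((disc6 A B C D E F : ℝ))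
        (((U : Matrix (Fin 3) (Fin 3) ℤ).map (Int.cast : ℤ → ℝ)).mulVec Ξ) Sg' := by
  change ∀ x, Phi6 A B C D E F (slAct U x) = Phi6 A B C D E F x at hU
  change bil (Phi6 A B C D E F) Sg' (slAct U Ξ) = 0 at h1'
  change ∀ c : ℝ, Sg' ≠ c • slAct U Ξ at h2'
  change _ = lambdaPhi _ _ (slAct U Ξ) Sg'
  obtain ⟨T, rfl⟩ : ∃ T, Sg' = slAct U T := ⟨_, (slAct_inv_apply U Sg').symm⟩
  rw [bil_slAct hU] at h1'
  have hT (c : ℝ) : T ≠ c • Ξ := by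
    rintro rfl
    exact h2' c (map_smul _ _ _)
  rw [lambdaPhi_slAct hU _ hΞ]
  exact le_antisymm (lambdaPhi_le_of_orthogonal hdisc hΞ hzero hirr h1' hT h1 h2 _)
    (lambdaPhi_le_of_orthogonal hdisc hΞ hzero hirr h1 h2 h1' hT _)
end
end

section
/- Let Φ be a ternary quadratic form with integer coefficients and discriminant Δ_Φ > 0, and let Ξ ∈ ℝ³ be nonzero with Φ(Ξ) = 0 and spanning an irrational line. If Σ₁, Σ₂ ∈ ℝ³ both satisfy ⟨Σᵢ,Ξ⟩_Φ = 0 and neither is a real scalar multiple of Ξ, then λ_Φ(Ξ;Σ₁) = λ_Φ(Ξ;Σ₂); that is, the Lagrange approximability of Ξ does not depend on the choice of Σ. -/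
noncomputable section
open Filter Topology
open scoped ENNReal LinearAlgebra.Projectivization

section BilinForm

variable {K V : Type*} [Field K] [AddCommGroup V] [Module K V]

lemma exists_combination_of_finrank_eq_three (hV : Module.finrank K V = 3) {x y z : V}
    (h : ∀ a b c : K, a • x + b • y + c • z = 0 → a = 0 ∧ b = 0 ∧ c = 0) (v : V) :
    ∃ a b c : K, v = a • x + b • y + c • z := by
  have hli : LinearIndependent K ![x, y, z] := by
    rw [Fintype.linearIndependent_iff]
    intro g hg
    obtain ⟨h0, h1, h2⟩ := h (g 0) (g 1) (g 2) (by simpa [Fin.sum_univ_three] using hg)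
    intro i
    fin_cases i <;> assumption
  have hv : v ∈ Submodule.span K (Set.range ![x, y, z]) := by
    rw [hli.span_eq_top_of_card_eq_finrank (by simp [hV])]
    trivial
  obtain ⟨c, hc⟩ := (Submodule.mem_span_range_iff_exists_fun K).1 hv
  exact ⟨c 0, c 1, c 2, by simpa [Fin.sum_univ_three] using hc.symm⟩

/-- In a nondegenerate ternary quadratic space, an isotropic line is its own set of isotropic
vectors within its orthogonal plane. -/
lemma apply_self_ne_zero_of_isotropic_orthogonal (hV : Module.finrank K V = 3)
    {β : LinearMap.BilinForm K V} (hsymm : ∀ u v, β u v = β v u)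
    (hnd : ∀ u, u ≠ 0 → ∃ w, β u w ≠ 0) {x y : V} (hx : x ≠ 0) (hxx : β x x = 0)
    (hyx : β y x = 0) (hy : ∀ c : K, y ≠ c • x) : β y y ≠ 0 := by
  intro hyy
  obtain ⟨w, hw⟩ := hnd x hx
  have hxy : β x y = 0 := by rw [hsymm, hyx]
  have hspan := exists_combination_of_finrank_eq_three (K := K) hV (x := x) (y := y) (z := w) (by
    intro a b c h
    have hc : c = 0 := by
      have := congrArg (β x) h
      simpa [hxx, hxy, hw] using this
    have hb : b = 0 := by
      by_contra hb
      apply hy (-(b⁻¹ * a))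
      have hb' : b • y = -(a • x) := by
        rw [hc, zero_smul, add_zero] at h
        exact eq_neg_of_add_eq_zero_right h
      rw [neg_smul, mul_smul, ← smul_neg, ← hb', inv_smul_smul₀ hb]
    refine ⟨?_, hb, hc⟩
    simpa [hb, hc, hx] using h)
  have hne : y - (β y w / β x w) • x ≠ 0 := fun h => hy _ (sub_eq_zero.1 h)
  obtain ⟨v, hv⟩ := hnd _ hne
  obtain ⟨a, b, c, rfl⟩ := hspan v
  apply hv
  simp only [map_add, map_sub, map_smul, LinearMap.sub_apply, LinearMap.smul_apply, smul_eq_mul,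
    hxx, hxy, hyx, hyy]
  field_simp
  ring

/-- An isotropic vector `x` and an orthogonal non-isotropic vector `y` extend to an orthogonal
decomposition of the space into `y` and a hyperbolic plane. -/
lemma exists_isotropic_complement [NeZero (2 : K)]
    {β : LinearMap.BilinForm K V} (hsymm : ∀ u v, β u v = β v u)
    (hnd : ∀ u, u ≠ 0 → ∃ w, β u w ≠ 0) {x y : V} (hx : x ≠ 0) (hxx : β x x = 0)
    (hyx : β y x = 0) (hyy : β y y ≠ 0) :
    ∃ z, β x z ≠ 0 ∧ β y z = 0 ∧ β z z = 0 := by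
  obtain ⟨w, hw⟩ := hnd x hx
  have hxy : β x y = 0 := by rw [hsymm, hyx]
  obtain ⟨u, hu⟩ : ∃ u, u = w - (β y w / β y y) • y := ⟨_, rfl⟩
  have hxu : β x u = β x w := by simp [hu, hxy]
  have hyu : β y u = 0 := by simp [hu, hyy]
  have hux : β u x = β x w := by rw [hsymm, hxu]
  have h2 : (2 : K) ≠ 0 := NeZero.ne 2
  refine ⟨u - (β u u / (2 * β x w)) • x, ?_, ?_, ?_⟩
  · simpa [hxu, hxx] using hw
  · simp [hyu, hyx]
  · simp only [map_sub, map_smul, LinearMap.sub_apply, LinearMap.smul_apply, smul_eq_mul, hxu, hux,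
      hxx]
    field_simp
    ring

lemma eq_combination_of_hyperbolic (hV : Module.finrank K V = 3)
    {β : LinearMap.BilinForm K V} (hsymm : ∀ u v, β u v = β v u) {x y z : V} (hxx : β x x = 0)
    (hyx : β y x = 0) (hyy : β y y ≠ 0) (hxz : β x z ≠ 0) (hyz : β y z = 0) (hzz : β z z = 0)
    (v : V) : v = (β z v / β x z) • x + (β y v / β y y) • y + (β x v / β x z) • z := by
  have hxy : β x y = 0 := by rw [hsymm, hyx]
  have hzy : β z y = 0 := by rw [hsymm, hyz]
  have hzx : β z x = β x z := hsymm _ _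
  obtain ⟨a, b, c, rfl⟩ := exists_combination_of_finrank_eq_three hV (x := x) (y := y) (z := z) (by
    intro a b c h
    refine ⟨?_, ?_, ?_⟩
    · simpa [hzx, hzy, hzz, hxz] using congrArg (β z) h
    · simpa [hyx, hyz, hyy] using congrArg (β y) h
    · simpa [hxx, hxy, hxz] using congrArg (β x) h) v
  simp [hxx, hxy, hyx, hyz, hzx, hzy, hzz, hxz, hyy]

lemma isotropic_relation (hV : Module.finrank K V = 3)
    {β : LinearMap.BilinForm K V} (hsymm : ∀ u v, β u v = β v u) {x y z : V} (hxx : β x x = 0)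
    (hyx : β y x = 0) (hyy : β y y ≠ 0) (hxz : β x z ≠ 0) (hyz : β y z = 0) (hzz : β z z = 0)
    {v : V} (hv : β v v = 0) : β y v ^ 2 * β x z = -(2 * β y y * β x v * β z v) := by
  have h := congrArg (β v) (eq_combination_of_hyperbolic hV hsymm hxx hyx hyy hxz hyz hzz v)
  rw [hv] at h
  rw [map_add, map_add, map_smul, map_smul, map_smul, hsymm v x, hsymm v y, hsymm v z] at h
  simp only [smul_eq_mul] at h
  field_simp at h
  linear_combination -h

end BilinForm

/-- The polar form of `Phi6` as a bilinear form. -/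
def phi6Bilin (A B C D E F : ℤ) : LinearMap.BilinForm ℝ V3 :=
  LinearMap.mk₂ ℝ (bil (Phi6 A B C D E F))
    (fun _ _ _ => by simp only [bil, Phi6, Pi.add_apply]; ring)
    (fun _ _ _ => by simp only [bil, Phi6, Pi.add_apply, Pi.smul_apply, smul_eq_mul]; ring)
    (fun _ _ _ => by simp only [bil, Phi6, Pi.add_apply]; ring)
    (fun _ _ _ => by simp only [bil, Phi6, Pi.add_apply, Pi.smul_apply, smul_eq_mul]; ring)

section Phi6

variable (A B C D E F : ℤ)

lemma phi6Bilin_apply (u v : V3) : phi6Bilin A B C D E F u v = bil (Phi6 A B C D E F) u v := rfl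

lemma phi6Bilin_self (u : V3) : phi6Bilin A B C D E F u u = Phi6 A B C D E F u := by
  simp only [phi6Bilin_apply, bil, Phi6, Pi.add_apply]; ring

lemma phi6Bilin_symm (u v : V3) : phi6Bilin A B C D E F u v = phi6Bilin A B C D E F v u := by
  simp only [phi6Bilin_apply, bil, Phi6, Pi.add_apply]; ring

variable {A B C D E F}

lemma exists_phi6Bilin_ne_zero (hdisc : disc6 A B C D E F ≠ 0) (u : V3) (hu : u ≠ 0) :
    ∃ w, phi6Bilin A B C D E F u w ≠ 0 := by
  by_contra! h
  have hd : (disc6 A B C D E F : ℝ) ≠ 0 := by exact_mod_cast hdisc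
  have h0 := h ![1, 0, 0]
  have h1 := h ![0, 1, 0]
  have h2 := h ![0, 0, 1]
  simp only [phi6Bilin_apply, bil, Phi6, Pi.add_apply, Matrix.cons_val_zero, Matrix.cons_val_one,
    Matrix.cons_val] at h0 h1 h2
  apply hu
  ext i
  apply mul_left_cancel₀ hd
  fin_cases i <;>
    simp only [disc6, Fin.zero_eta, Fin.mk_one, Fin.reduceFinMk, Pi.zero_apply, mul_zero] <;>
    push_cast
  · linear_combination (4 * C * F - E ^ 2 : ℝ) * h0 + (D * E - 2 * B * F : ℝ) * h1 +
      (B * E - 2 * C * D : ℝ) * h2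
  · linear_combination (D * E - 2 * B * F : ℝ) * h0 + (4 * A * F - D ^ 2 : ℝ) * h1 +
      (B * D - 2 * A * E : ℝ) * h2
  · linear_combination (B * E - 2 * C * D : ℝ) * h0 + (B * D - 2 * A * E : ℝ) * h1 +
      (4 * A * C - B ^ 2 : ℝ) * h2

end Phi6

/-- A homogeneous strict inequality between continuous functions that holds at `v` holds on a
neighbourhood of the projective point `[v]`. -/
lemma eventually_nhds_mk_of_homogeneous {f g : V3 → ℝ} (hf : Continuous f) (hg : Continuous g)
    (hf' : ∀ (a : ℝ) v, f (a • v) = |a| * f v) (hg' : ∀ (a : ℝ) v, g (a • v) = |a| * g v)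
    {v : V3} (hv : v ≠ 0) (h : f v < g v) :
    ∀ᶠ p in 𝓝 (Projectivization.mk ℝ v hv),
      ∀ (w : V3) (hw : w ≠ 0), p = Projectivization.mk ℝ w hw → f w < g w := by
  have hrep : ∀ (w : V3) (hw : w ≠ 0), f (Projectivization.mk ℝ w hw).rep <
      g (Projectivization.mk ℝ w hw).rep ↔ f w < g w := by
    intro w hw
    obtain ⟨a, ha⟩ := Projectivization.exists_smul_eq_mk_rep ℝ w hw
    rw [← ha, Units.smul_def, hf', hg', mul_lt_mul_iff_right₀ (abs_pos.2 a.ne_zero)]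
  have hopen : IsOpen {p : ℙ ℝ V3 | f p.rep < g p.rep} := by
    rw [isOpen_coinduced]
    have : Projectivization.mk' ℝ ⁻¹' {p : ℙ ℝ V3 | f p.rep < g p.rep} =
        {w : {w : V3 // w ≠ 0} | f w < g w} := by
      ext w
      exact hrep w w.2
    rw [this]
    exact isOpen_lt (hf.comp continuous_subtype_val) (hg.comp continuous_subtype_val)
  filter_upwards [hopen.mem_nhds ((hrep v hv).2 h)] with p hp w hw hpw
  subst hpw
  exact (hrep w hw).1 hp

/-- Near an isotropic point `[x]`, the pairing with `x` of points of the conic is negligible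
compared to their pairing with any other vector of the tangent line. -/
lemma eventually_abs_le_mul_abs {β : LinearMap.BilinForm ℝ V3} (hsymm : ∀ u v, β u v = β v u)
    {x y z : V3} (hx : x ≠ 0) (hxx : β x x = 0)
    (hyx : β y x = 0) (hyy : β y y ≠ 0) (hxz : β x z ≠ 0) (hyz : β y z = 0) (hzz : β z z = 0)
    {ε : ℝ} (hε : 0 < ε) :
    ∀ᶠ p in 𝓝 (Projectivization.mk ℝ x hx), ∀ (w : V3) (hw : w ≠ 0), β w w = 0 →
      p = Projectivization.mk ℝ w hw → |β x w| ≤ ε * |β y w| := by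
  have hV : Module.finrank ℝ V3 = 3 := by simp
  have hcont : ∀ u, Continuous fun w => β u w := fun u =>
    LinearMap.continuous_of_finiteDimensional (β u)
  filter_upwards [eventually_nhds_mk_of_homogeneous (v := x)
    (f := fun w => |β y w| * |β x z|) (g := fun w => ε * (2 * |β y y| * |β z w|))
    ((hcont y).abs.mul continuous_const)
    (continuous_const.mul (continuous_const.mul (hcont z).abs))
    (fun a w => by simp only [map_smul, smul_eq_mul, abs_mul]; ring)
    (fun a w => by simp only [map_smul, smul_eq_mul, abs_mul]; ring) hx
    (by
      rw [hyx, hsymm z x, abs_zero, zero_mul]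
      have := abs_pos.2 hyy
      have := abs_pos.2 hxz
      positivity)] with p hp w hw hww hpw
  have hlt := hp w hw hpw
  have hrel := congrArg abs (isotropic_relation hV hsymm hxx hyx hyy hxz hyz hzz hww)
  simp only [abs_neg, abs_mul, abs_pow, Nat.abs_ofNat] at hrel
  have hpos : 0 < 2 * |β y y| * |β z w| := by
    refine pos_of_mul_pos_right (lt_of_le_of_lt ?_ hlt) hε.le
    positivity
  refine le_of_mul_le_mul_right ?_ hpos
  calc |β x w| * (2 * |β y y| * |β z w|) = |β y w| * (|β y w| * |β x z|) := by
        linear_combination -hrel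
    _ ≤ |β y w| * (ε * (2 * |β y y| * |β z w|)) := by gcongr
    _ = ε * |β y w| * (2 * |β y y| * |β z w|) := by ring

lemma exists_pos_forall_div_abs_add_le {a : ℝ} (ha : a ≠ 0) (b : ℝ) {c : ℝ} (hc : 1 < c) :
    ∃ ε > 0, ∀ N, 0 ≤ N → ∀ x y : ℝ, |x| ≤ ε * |y| →
      |a| * N / |b * x + a * y| ≤ c * (N / |y|) := by
  have ha' := abs_pos.2 ha
  have hc0 : 0 < c := one_pos.trans hc
  have hε : 0 < (1 - 1 / c) * |a| / (|b| + 1) :=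
    div_pos (mul_pos (sub_pos.2 ((div_lt_one hc0).2 hc)) ha') (by positivity)
  refine ⟨_, hε, fun N hN x y hxy => ?_⟩
  rcases eq_or_ne y 0 with rfl | hy
  · have hx : x = 0 := by simpa using hxy
    simp [hx]
  have hy' := abs_pos.2 hy
  have hbx : |b * x| ≤ (1 - 1 / c) * |a| * |y| := by
    rw [abs_mul]
    calc |b| * |x| ≤ (|b| + 1) * ((1 - 1 / c) * |a| / (|b| + 1) * |y|) := by
          gcongr
          linarith
      _ = (1 - 1 / c) * |a| * |y| := by field_simp
  have hsum : |a| * |y| / c ≤ |b * x + a * y| := by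
    have h := abs_sub_abs_le_abs_sub (a * y) (-(b * x))
    rw [abs_neg, abs_mul, sub_neg_eq_add, add_comm (a * y)] at h
    have : (1 - 1 / c) * |a| * |y| = |a| * |y| - |a| * |y| / c := by ring
    linarith
  have hpos : 0 < |a| * |y| / c := by positivity
  rw [div_le_iff₀ (hpos.trans_le hsum)]
  calc |a| * N = c * (N / |y|) * (|a| * |y| / c) := by field_simp
    _ ≤ c * (N / |y|) * |b * x + a * y| := by gcongr

/-- One of the two inequalities between the approximabilities for two tangent vectors. -/
lemma lambdaPhi_le_of_tangent {A B C D E F : ℤ} (hdisc : disc6 A B C D E F ≠ 0)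
    {Ξ : V3} (hΞ : Ξ ≠ 0) (hzero : Phi6 A B C D E F Ξ = 0) {S T : V3}
    (hS : bil (Phi6 A B C D E F) S Ξ = 0) (hS' : ∀ c : ℝ, S ≠ c • Ξ)
    (hT : bil (Phi6 A B C D E F) T Ξ = 0) (hT' : ∀ c : ℝ, T ≠ c • Ξ) (Δ : ℝ) :
    lambdaPhi (Phi6 A B C D E F) Δ Ξ T ≤ lambdaPhi (Phi6 A B C D E F) Δ Ξ S := by
  have hV : Module.finrank ℝ V3 = 3 := by simp
  set β := phi6Bilin A B C D E F with hβ
  have hsymm : ∀ u v, β u v = β v u := phi6Bilin_symm A B C D E F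
  have hself : ∀ u, β u u = Phi6 A B C D E F u := phi6Bilin_self A B C D E F
  have hnd := exists_phi6Bilin_ne_zero hdisc
  have hxx : β Ξ Ξ = 0 := (hself Ξ).trans hzero
  have hSS : β S S ≠ 0 :=
    apply_self_ne_zero_of_isotropic_orthogonal hV hsymm hnd hΞ hxx hS hS'
  obtain ⟨Z, hxz, hyz, hzz⟩ := exists_isotropic_complement hsymm hnd hΞ hxx hS hSS
  obtain ⟨a, b, ha, rfl⟩ : ∃ a b : ℝ, a ≠ 0 ∧ T = b • Ξ + a • S := by
    have hTeq := eq_combination_of_hyperbolic hV hsymm hxx hS hSS hxz hyz hzz T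
    rw [show β Ξ T = 0 from (hsymm _ _).trans hT, zero_div, zero_smul, add_zero] at hTeq
    refine ⟨_, _, fun h => ?_, hTeq⟩
    rw [h, zero_smul, add_zero] at hTeq
    exact hT' _ hTeq
  have hnum : √(Δ * |Phi6 A B C D E F (b • Ξ + a • S)|) =
      |a| * √(Δ * |Phi6 A B C D E F S|) := by
    rw [← hself, ← hself]
    have : β (b • Ξ + a • S) (b • Ξ + a • S) = a ^ 2 * β S S := by
      have h : β Ξ S = 0 := (hsymm _ _).trans hS
      have h' : β S Ξ = 0 := hS
      simp only [map_add, map_smul, LinearMap.add_apply, LinearMap.smul_apply, smul_eq_mul, hxx, h,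
        h']
      ring
    rw [this, abs_mul, abs_of_nonneg (sq_nonneg a), mul_left_comm,
      Real.sqrt_mul (sq_nonneg a), Real.sqrt_sq_eq_abs]
  have hbound : ∀ c : ℝ, 1 < c → lambdaPhi (Phi6 A B C D E F) Δ Ξ (b • Ξ + a • S) ≤
      ENNReal.ofReal c * lambdaPhi (Phi6 A B C D E F) Δ Ξ S := by
    intro c hc
    obtain ⟨ε, hε, hεc⟩ := exists_pos_forall_div_abs_add_le ha b hc
    simp only [lambdaPhi, dif_pos hΞ]
    rw [← ENNReal.limsup_const_mul_of_ne_top ENNReal.ofReal_ne_top]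
    refine limsup_le_limsup ?_
    filter_upwards [(eventually_abs_le_mul_abs hsymm hΞ hxx hS hSS hxz hyz hzz hε).comap
      fun P : ConicPts (Phi6 A B C D E F) => Projectivization.mk ℝ (intCast3 P.1) P.2.1] with P hP
    rw [← ENNReal.ofReal_mul (by positivity), hnum]
    refine ENNReal.ofReal_le_ofReal ?_
    have hxP := hP (intCast3 P.1) P.2.1 ((hself _).trans P.2.2) rfl
    have hadd : bil (Phi6 A B C D E F) (b • Ξ + a • S) (intCast3 P.1) =
        b * β Ξ (intCast3 P.1) + a * β S (intCast3 P.1) := by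
      rw [← phi6Bilin_apply, ← hβ]
      simp only [map_add, map_smul, LinearMap.add_apply, LinearMap.smul_apply, smul_eq_mul]
    rw [hadd]
    exact hεc _ (Real.sqrt_nonneg _) _ _ hxP
  have hlim : Tendsto (fun c : ℝ => ENNReal.ofReal c * lambdaPhi (Phi6 A B C D E F) Δ Ξ S)
      (𝓝[>] 1) (𝓝 (lambdaPhi (Phi6 A B C D E F) Δ Ξ S)) := by
    have h : Tendsto ENNReal.ofReal (𝓝[>] 1) (𝓝 1) := by
      simpa using (ENNReal.continuous_ofReal.tendsto 1).mono_left nhdsWithin_le_nhds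
    simpa using ENNReal.Tendsto.mul_const h (Or.inl one_ne_zero)
  exact ge_of_tendsto hlim (eventually_mem_nhdsWithin.mono hbound)

/-- Lemma 2.1: the Lagrange approximability `λ_Φ(Ξ; Σ)` does not depend
on the choice of `Σ` on the tangent line at `Ξ`. -/
theorem stmt3 (A B C D E F : ℤ) (hdisc : 0 < disc6 A B C D E F)
    (Ξ : V3) (hΞ : Ξ ≠ 0) (hzero : Phi6 A B C D E F Ξ = 0) (hirr : IrrationalLine Ξ)
    (Sg1 Sg2 : V3)
    (h1 : bil (Phi6 A B C D E F) Sg1 Ξ = 0) (h1' : ∀ c : ℝ, Sg1 ≠ c • Ξ)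
    (h2 : bil (Phi6 A B C D E F) Sg2 Ξ = 0) (h2' : ∀ c : ℝ, Sg2 ≠ c • Ξ) :
    lambdaPhi (Phi6 A B C D E F) ((disc6 A B C D E F : ℝ)) Ξ Sg1 =
      lambdaPhi (Phi6 A B C D E F) ((disc6 A B C D E F : ℝ)) Ξ Sg2 := by
  exact le_antisymm (lambdaPhi_le_of_tangent hdisc.ne' hΞ hzero h2 h2' h1 h1' _)
    (lambdaPhi_le_of_tangent hdisc.ne' hΞ hzero h1 h1' h2 h2' _)

end
end

section
/- Let a, b, c be real numbers with b² − 4ac > 0, and set Σ = (c, −b/2, a) ∈ ℝ³. For Φ₁(X,Y,Z) = −Y² + X·Z (which has discriminant Δ = 1 and satisfies Φ₁(Σ) = ac − b²/4 < 0), the Markoff approximability satisfies μ_{Φ₁}(Σ) = sup over pairs (s,t) ∈ ℤ²∖{(0,0)} with a·s² + b·s·t + c·t² ≠ 0 of √(b² − 4ac)/|a·s² + b·s·t + c·t²|, as an equality in [0,∞]. -/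
noncomputable section
open Filter Topology
open scoped ENNReal LinearAlgebra.Projectivization

/-- Every integer zero of `XZ - Y²` is an integer multiple of a point `(s², st, t²)`. -/
theorem exists_eq_mul_sq_of_mul_eq_sq {x y z : ℤ} (h : x * z = y ^ 2) :
    ∃ k s t : ℤ, x = k * s ^ 2 ∧ y = k * (s * t) ∧ z = k * t ^ 2 := by
  rcases eq_or_ne x 0 with rfl | hx
  · have hy : y = 0 := by simpa using h.symm
    exact ⟨z, 0, 1, by simp, by simp [hy], by simp⟩
  · obtain ⟨g, s, t, hg, hst, hxs, hyt⟩ :=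
      Int.exists_gcd_one' (m := x) (n := y) (Int.gcd_pos_of_ne_zero_left y hx)
    have hs : s ≠ 0 := by
      rintro rfl
      exact hx (by simpa using hxs)
    have hg' : (g : ℤ) ≠ 0 := by exact_mod_cast hg.ne'
    have key : s * z = t ^ 2 * g := by
      apply mul_left_cancel₀ hg'
      rw [hxs, hyt] at h
      linear_combination h
    have hdvd : s ∣ (g : ℤ) :=
      ((Int.isCoprime_iff_gcd_eq_one.mpr hst).pow_right (n := 2)).dvd_of_dvd_mul_left
        ⟨z, key.symm⟩
    obtain ⟨k, hk⟩ := hdvd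
    refine ⟨k, s, t, by rw [hxs, hk]; ring, by rw [hyt, hk]; ring, ?_⟩
    apply mul_left_cancel₀ hs
    rw [key, hk]
    ring

theorem bil_Phi6_eq (a b c : ℝ) (Q : V3) :
    bil (Phi6 0 0 (-1) 1 0 0) ![c, -b / 2, a] Q = (a * Q 0 + b * Q 1 + c * Q 2) / 2 := by
  simp [bil, Phi6]
  ring

theorem sqrt_abs_Phi6_eq {a b c : ℝ} (h : 0 < b ^ 2 - 4 * a * c) :
    √(1 * |Phi6 0 0 (-1) 1 0 0 ![c, -b / 2, a]|) = √(b ^ 2 - 4 * a * c) / 2 := by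
  have e : Phi6 0 0 (-1) 1 0 0 ![c, -b / 2, a] = -((b ^ 2 - 4 * a * c) / 2 ^ 2) := by
    simp [Phi6]
    ring
  rw [e, abs_neg, abs_of_pos (by positivity), one_mul, Real.sqrt_div h.le,
    Real.sqrt_sq zero_le_two]

/-- for `Φ₁ = -Y² + XZ` and `Σ = (c, -b/2, a)` with `b² - 4ac > 0`, the
Markoff approximability `μ_{Φ₁}(Σ)` equals the classical supremum
`sup √(b²-4ac)/|a s² + b s t + c t²|` over integer pairs `(s,t) ≠ (0,0)` where the form
does not vanish. -/
theorem stmt5 (a b c : ℝ) (h : 0 < b ^ 2 - 4 * a * c) :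
    muPhi (Phi6 0 0 (-1) 1 0 0) 1 ![c, -b / 2, a] =
      ⨆ (st : ℤ × ℤ) (_ : st ≠ 0)
        (_ : a * (st.1 : ℝ) ^ 2 + b * st.1 * st.2 + c * (st.2 : ℝ) ^ 2 ≠ 0),
        ENNReal.ofReal (Real.sqrt (b ^ 2 - 4 * a * c) /
          |a * (st.1 : ℝ) ^ 2 + b * st.1 * st.2 + c * (st.2 : ℝ) ^ 2|) := by
  have hterm (q : ℝ) : √(b ^ 2 - 4 * a * c) / 2 / |q / 2| = √(b ^ 2 - 4 * a * c) / |q| := by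
    rw [abs_div, abs_two, div_div_div_cancel_right₀ two_ne_zero]
  simp only [muPhi, bil_Phi6_eq, sqrt_abs_Phi6_eq h, hterm]
  apply le_antisymm
  · refine iSup_le fun P => iSup_le fun _ => iSup_le fun hP => iSup_le fun hQ => ?_
    have hP' : P 0 * P 2 = P 1 ^ 2 := by
      have : (P 0 : ℝ) * P 2 = (P 1 : ℝ) ^ 2 := by
        simp only [Phi6, intCast3] at hP
        push_cast at hP
        linear_combination hP
      exact_mod_cast this
    obtain ⟨k, s, t, h0, h1, h2⟩ := exists_eq_mul_sq_of_mul_eq_sq hP'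
    have e : a * intCast3 P 0 + b * intCast3 P 1 + c * intCast3 P 2 =
        k * (a * (s : ℝ) ^ 2 + b * s * t + c * (t : ℝ) ^ 2) := by
      simp only [intCast3, h0, h1, h2]
      push_cast
      ring
    rw [e] at hQ ⊢
    have hkq := (div_ne_zero_iff.mp hQ).1
    have hk : k ≠ 0 := by
      rintro rfl
      simp at hkq
    have hq := right_ne_zero_of_mul hkq
    have hst : (s, t) ≠ 0 := by
      intro h0
      obtain ⟨rfl, rfl⟩ := Prod.mk.inj h0
      simp at hq
    refine le_trans (ENNReal.ofReal_le_ofReal ?_)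
      (le_iSup₂_of_le (s, t) hst (le_iSup_of_le hq le_rfl))
    have hk1 : (1 : ℝ) ≤ |(k : ℝ)| := by exact_mod_cast Int.one_le_abs hk
    have hq' := abs_pos.mpr hq
    rw [abs_mul]
    gcongr
    exact le_mul_of_one_le_left hq'.le hk1
  · refine iSup_le fun ⟨s, t⟩ => iSup_le fun hst => iSup_le fun hq => ?_
    have e : a * intCast3 ![s ^ 2, s * t, t ^ 2] 0 + b * intCast3 ![s ^ 2, s * t, t ^ 2] 1 +
        c * intCast3 ![s ^ 2, s * t, t ^ 2] 2 =
          a * (s : ℝ) ^ 2 + b * s * t + c * (t : ℝ) ^ 2 := by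
      simp [intCast3]
      ring
    refine le_iSup₂_of_le ![s ^ 2, s * t, t ^ 2] ?_ (le_iSup₂_of_le ?_ ?_ ?_)
    · intro h0
      rw [h0] at e
      exact hq (by simpa using e.symm)
    · simp [Phi6, intCast3]
      ring
    · rw [e]
      exact div_ne_zero hq two_ne_zero
    · rw [e]

end
end

section
/- Let ξ be an irrational real number, and set Ξ = (ξ², ξ, 1) and Σ = (2ξ, 1, 0) in ℝ³. For Φ₁(X,Y,Z) = −Y² + X·Z one has ⟨Σ,Ξ⟩ = 0, and the Lagrange approximability satisfies λ_{Φ₁}(Ξ;Σ) = limsup_{q ∈ ℚ, q → ξ} 1/(den(q)² · |q − ξ|), where den(q) is the reduced positive denominator of q; that is, the Lagrange approximability of the point [ξ² : ξ : 1] of the Veronese conic equals the classical approximability of ξ. -/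
noncomputable section
open Filter Topology
open scoped ENNReal LinearAlgebra.Projectivization

lemma Phi6_veronese (P : V3) : Phi6 0 0 (-1) 1 0 0 P = P 0 * P 2 - P 1 ^ 2 := by
  simp only [Phi6]
  push_cast
  ring

lemma bil_veronese_tangent (ξ : ℝ) (P : V3) :
    bil (Phi6 0 0 (-1) 1 0 0) ![2 * ξ, 1, 0] P = ξ * P 2 - P 1 := by
  simp only [bil, Phi6_veronese, Pi.add_apply, Matrix.cons_val]
  ring

lemma continuous_projectivization_mk' : Continuous (Projectivization.mk' ℝ : _ → ℙ ℝ V3) :=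
  continuous_coinduced_rng

/-- The affine coordinate `Y / Z` is continuous on the chart `Z ≠ 0` of `ℙ²(ℝ)`. -/
lemma eventually_div_mem {v : V3} (hv : v ≠ 0) (hv2 : v 2 ≠ 0) {U : Set ℝ}
    (hU : U ∈ 𝓝 (v 1 / v 2)) :
    ∀ᶠ p in 𝓝 (Projectivization.mk ℝ v hv),
      ∀ w (hw : w ≠ 0), Projectivization.mk ℝ w hw = p → w 2 ≠ 0 ∧ w 1 / w 2 ∈ U := by
  obtain ⟨O, hOU, hO, hvO⟩ := mem_nhds_iff.1 hU
  let S : Set (ℙ ℝ V3) :=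
    {p | ∀ w (hw : w ≠ 0), Projectivization.mk ℝ w hw = p → w 2 ≠ 0 ∧ w 1 / w 2 ∈ O}
  have hmk (u : V3) (hu : u ≠ 0) :
      Projectivization.mk ℝ u hu ∈ S ↔ u 2 ≠ 0 ∧ u 1 / u 2 ∈ O := by
    refine ⟨fun h => h u hu rfl, ?_⟩
    rintro ⟨h2, hO⟩ w hw hwu
    obtain ⟨a, rfl⟩ := (Projectivization.mk_eq_mk_iff' ℝ w u hw hu).1 hwu
    have ha : a ≠ 0 := by
      rintro rfl
      simp at hw
    simp only [Pi.smul_apply, smul_eq_mul, mul_div_mul_left _ _ ha]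
    exact ⟨mul_ne_zero ha h2, hO⟩
  have hS : IsOpen S := by
    refine isOpen_coinduced.2 ?_
    have hpre : Projectivization.mk' ℝ ⁻¹' S =
        {u : {u : V3 // u ≠ 0} | u.1 2 ≠ 0 ∧ u.1 1 / u.1 2 ∈ O} := by
      ext u
      exact hmk u.1 u.2
    rw [hpre, isOpen_iff_mem_nhds]
    rintro u ⟨h2, hu⟩
    have c (i : Fin 3) : ContinuousAt (fun u : {u : V3 // u ≠ 0} => u.1 i) u :=
      ((continuous_apply i).comp continuous_subtype_val).continuousAt
    exact ((c 2).eventually_ne h2).and (((c 1).div (c 2) h2) (hO.mem_nhds hu))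
  filter_upwards [hS.mem_nhds ((hmk v hv).2 ⟨hv2, hvO⟩)] with p hp w hw hwp
  exact ⟨(hp w hw hwp).1, hOU (hp w hw hwp).2⟩

lemma den_sq_le_abs {X Y Z : ℤ} (hZ : Z ≠ 0) (h : X * Z = Y ^ 2) :
    (((Y : ℚ) / Z).den : ℤ) ^ 2 ≤ |Z| := by
  set r : ℚ := (Y : ℚ) / Z
  have hZ' : (Z : ℚ) ≠ 0 := by exact_mod_cast hZ
  have hd : (r.den : ℚ) ≠ 0 := by exact_mod_cast r.den_ne_zero
  have hrY : r * Z = Y := div_mul_cancel₀ _ hZ'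
  have hrn : r * r.den = r.num := Rat.mul_den_eq_num r
  have hX : (X : ℚ) = r ^ 2 * Z := by
    have h' : (X : ℚ) * Z = Y ^ 2 := by exact_mod_cast h
    apply mul_right_cancel₀ hZ'
    rw [h', ← hrY]
    ring
  have key : X * (r.den : ℤ) ^ 2 = r.num ^ 2 * Z := by
    have : (X : ℚ) * (r.den : ℚ) ^ 2 = (r.num : ℚ) ^ 2 * Z := by
      rw [hX, ← hrn]
      ring
    exact_mod_cast this
  have hcop : IsCoprime ((r.den : ℤ) ^ 2) (r.num ^ 2) :=
    (Rat.isCoprime_num_den r).symm.pow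
  have hdvd : (r.den : ℤ) ^ 2 ∣ Z := hcop.dvd_of_dvd_mul_left ⟨X, by rw [← key]; ring⟩
  exact Int.le_of_dvd (abs_pos.2 hZ) ((dvd_abs _ _).2 hdvd)

/-- The primitive integer point of the Veronese conic with affine coordinate `q`. -/
def veronesePt (q : ℚ) : ConicPts (Phi6 0 0 (-1) 1 0 0) :=
  ⟨![q.num ^ 2, q.num * q.den, (q.den : ℤ) ^ 2],
    fun h => by simpa [intCast3] using congrFun h 2,
    by
      simp only [Phi6_veronese, intCast3, Matrix.cons_val]
      push_cast
      ring⟩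

lemma cons_cons_one_ne_zero (a b : ℝ) : (![a, b, 1] : V3) ≠ 0 :=
  fun h => by simpa using congrFun h 2

lemma mk_veronesePt (q : ℚ) :
    Projectivization.mk ℝ (intCast3 (veronesePt q).1) (veronesePt q).2.1 =
      Projectivization.mk ℝ ![(q : ℝ) ^ 2, q, 1] (cons_cons_one_ne_zero _ _) := by
  refine (Projectivization.mk_eq_mk_iff' ℝ _ _ _ _).2 ⟨(q.den : ℝ) ^ 2, ?_⟩
  have h : (q.num : ℝ) = q * q.den := by exact_mod_cast (Rat.mul_den_eq_num q).symm
  ext i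
  fin_cases i <;> simp [veronesePt, intCast3, h] <;> ring

/-- for `Φ₁ = -Y² + XZ`, `Ξ = (ξ², ξ, 1)` and `Σ = (2ξ, 1, 0)` with `ξ`
irrational, `⟨Σ,Ξ⟩ = 0` and the Lagrange approximability of `[ξ² : ξ : 1]` equals the
classical approximability of `ξ`. -/
theorem stmt6 (ξ : ℝ) (hξ : Irrational ξ) :
    bil (Phi6 0 0 (-1) 1 0 0) ![2 * ξ, 1, 0] ![ξ ^ 2, ξ, 1] = 0 ∧
    lambdaPhi (Phi6 0 0 (-1) 1 0 0) 1 ![ξ ^ 2, ξ, 1] ![2 * ξ, 1, 0] = lambdaCl ξ := by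
  refine ⟨?_, ?_⟩
  · rw [bil_veronese_tangent]
    simp
  have hΞ := cons_cons_one_ne_zero (ξ ^ 2) ξ
  have hdet : √(1 * |Phi6 0 0 (-1) 1 0 0 ![2 * ξ, 1, 0]|) = 1 := by simp [Phi6_veronese]
  rw [lambdaPhi, dif_pos hΞ, lambdaCl]
  simp only [hdet, bil_veronese_tangent]
  apply le_antisymm
  · have hev {U : Set ℝ} (hU : U ∈ 𝓝 ξ) := (eventually_div_mem hΞ (by simp) (U := U)
      (by simpa using hU)).comap
        (fun P : ConicPts (Phi6 0 0 (-1) 1 0 0) => Projectivization.mk ℝ (intCast3 P.1) P.2.1)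
    have ht : Tendsto
        (fun P : ConicPts (Phi6 0 0 (-1) 1 0 0) => ((P.1 1 : ℚ) / (P.1 2 : ℚ)))
        (comap (fun P : ConicPts (Phi6 0 0 (-1) 1 0 0) =>
          Projectivization.mk ℝ (intCast3 P.1) P.2.1)
          (𝓝 (Projectivization.mk ℝ ![ξ ^ 2, ξ, 1] hΞ)))
        (comap (fun q : ℚ => (q : ℝ)) (𝓝 ξ)) := by
      refine tendsto_comap_iff.2 fun U hU => mem_map.2 ?_
      filter_upwards [hev hU] with P hP
      simpa [intCast3] using (hP _ P.2.1 rfl).2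
    refine le_trans ?_ (limsup_le_limsup_of_le ht)
    rw [← limsup_comp]
    refine limsup_le_limsup ?_
    filter_upwards [hev univ_mem] with P hP
    have hZ : P.1 2 ≠ 0 := by simpa [intCast3] using (hP _ P.2.1 rfl).1
    have hP0 : P.1 0 * P.1 2 = P.1 1 ^ 2 := by
      have := P.2.2
      rw [Phi6_veronese, sub_eq_zero] at this
      simp only [intCast3] at this
      exact_mod_cast this
    have hle : ((((P.1 1 : ℚ) / (P.1 2 : ℚ)).den : ℝ)) ^ 2 ≤ |(P.1 2 : ℝ)| := by
      exact_mod_cast den_sq_le_abs hZ hP0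
    simp only [Function.comp_apply]
    set r : ℚ := (P.1 1 : ℚ) / (P.1 2 : ℚ) with hr
    have hrY : (r : ℝ) * P.1 2 = P.1 1 := by
      rw [hr]
      push_cast
      exact div_mul_cancel₀ _ (by exact_mod_cast hZ)
    have heq : |ξ * intCast3 P.1 2 - intCast3 P.1 1| = |(P.1 2 : ℝ)| * |(r : ℝ) - ξ| := by
      rw [← abs_mul, abs_sub_comm]
      simp only [intCast3, ← hrY]
      ring_nf
    rw [heq]
    have hpos : 0 < |(r : ℝ) - ξ| := abs_pos.2 (sub_ne_zero.2 (hξ.ne_rat r).symm)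
    have hden : (0 : ℝ) < r.den := by exact_mod_cast r.den_pos
    gcongr
  · have ht : Tendsto veronesePt (comap (fun q : ℚ => (q : ℝ)) (𝓝 ξ))
        (comap (fun P : ConicPts (Phi6 0 0 (-1) 1 0 0) =>
          Projectivization.mk ℝ (intCast3 P.1) P.2.1)
          (𝓝 (Projectivization.mk ℝ ![ξ ^ 2, ξ, 1] hΞ))) := by
      refine tendsto_comap_iff.2 ?_
      have hc : Continuous fun x : ℝ =>
          Projectivization.mk ℝ (![x ^ 2, x, 1] : V3) (cons_cons_one_ne_zero _ _) := by
        refine continuous_projectivization_mk'.comp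
          (f := fun x : ℝ => ⟨(![x ^ 2, x, 1] : V3), cons_cons_one_ne_zero _ _⟩) ?_
        refine Continuous.subtype_mk (continuous_pi fun i => ?_) _
        fin_cases i <;> simp <;> fun_prop
      exact ((hc.tendsto ξ).comp tendsto_comap).congr fun q => (mk_veronesePt q).symm
    refine le_trans (le_of_eq ?_) (limsup_le_limsup_of_le ht)
    rw [← limsup_comp]
    congr 1
    ext1 q
    have h : (q.num : ℝ) = q * q.den := by exact_mod_cast (Rat.mul_den_eq_num q).symm
    have heq : |ξ * intCast3 (veronesePt q).1 2 - intCast3 (veronesePt q).1 1| =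
        (q.den : ℝ) ^ 2 * |(q : ℝ) - ξ| := by
      have hd : |(q.den : ℝ) ^ 2| = (q.den : ℝ) ^ 2 := abs_of_nonneg (sq_nonneg _)
      rw [← hd, ← abs_mul, abs_sub_comm]
      simp only [veronesePt, intCast3, Matrix.cons_val]
      push_cast
      rw [h]
      ring_nf
    simp only [Function.comp_apply, heq]

end
end

section
/- Let Φ be a ternary quadratic form with integer coefficients, discriminant Δ_Φ > 0, and a nonzero integer zero (Φ is isotropic). Then there exist U ∈ SL₃(ℤ) and integers A, B, C, D with C ≥ 1 and D ≥ 1 such that Φ(U·(X,Y,Z)) = −A·X² − B·X·Y − C·Y² + D·X·Z for all (X,Y,Z) ∈ ℝ³. -/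
noncomputable section
open Filter Topology
open scoped ENNReal LinearAlgebra.Projectivization

/-- The form with the given coefficients is `SL₃(ℤ)`-equivalent to a standard form
`-A X² - B XY - C Y² + D XZ` with `C, D ≥ 1`. -/
def HasStandardForm (A B C D E F : ℤ) : Prop :=
  ∃ (U : Matrix.SpecialLinearGroup (Fin 3) ℤ) (A' B' C' D' : ℤ),
    1 ≤ C' ∧ 1 ≤ D' ∧
    ∀ x : V3,
      Phi6 A B C D E F (((U : Matrix (Fin 3) (Fin 3) ℤ).map (Int.cast : ℤ → ℝ)).mulVec x) =
        Phi6 (-A') (-B') (-C') D' 0 0 x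

/-- Every pair of integers is a nonnegative multiple of a coprime pair. -/
lemma exists_eq_mul_coprime (x y : ℤ) :
    ∃ g p q u v : ℤ, 0 ≤ g ∧ x = g * p ∧ y = g * q ∧ u * p + v * q = 1 := by
  rcases Nat.eq_zero_or_pos (Int.gcd x y) with h | h
  · obtain ⟨rfl, rfl⟩ := Int.gcd_eq_zero_iff.mp h
    exact ⟨0, 1, 0, 1, 0, by simp⟩
  · obtain ⟨p, q, hpq, hx, hy⟩ := Int.exists_gcd_one h
    obtain ⟨u, v, huv⟩ := Int.isCoprime_iff_gcd_eq_one.mpr hpq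
    exact ⟨Int.gcd x y, p, q, u, v, by positivity, by linarith, by linarith, huv⟩

/-- Having a standard form is invariant under unimodular substitutions. -/
lemma HasStandardForm.of_mulVec {A B C D E F A' B' C' D' E' F' : ℤ}
    (M : Matrix (Fin 3) (Fin 3) ℤ) (hM : M.det = 1)
    (hsub : ∀ x : V3, Phi6 A B C D E F ((M.map (Int.cast : ℤ → ℝ)).mulVec x) =
      Phi6 A' B' C' D' E' F' x)
    (h : HasStandardForm A' B' C' D' E' F') : HasStandardForm A B C D E F := by
  obtain ⟨U, a, b, c, d, hc, hd, hU⟩ := h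
  obtain ⟨V, rfl⟩ : ∃ V : Matrix.SpecialLinearGroup (Fin 3) ℤ, (V : Matrix _ _ ℤ) = M :=
    ⟨⟨M, hM⟩, rfl⟩
  refine ⟨V * U, a, b, c, d, hc, hd, fun x => ?_⟩
  rw [← hU x, ← hsub, Matrix.mulVec_mulVec, Matrix.SpecialLinearGroup.coe_mul]
  congr 2
  exact Matrix.map_mul (f := Int.castRingHom ℝ)

/-- The unimodular substitution `(X, Y) ↦ (aX + bY, cX + dY)`. -/
lemma HasStandardForm.of_subst_XY {A B C D E F : ℤ} (a b c d : ℤ) (hdet : a * d - b * c = 1)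
    (h : HasStandardForm (A * a ^ 2 + B * a * c + C * c ^ 2)
      (2 * A * a * b + B * (a * d + b * c) + 2 * C * c * d)
      (A * b ^ 2 + B * b * d + C * d ^ 2) (D * a + E * c) (D * b + E * d) F) :
    HasStandardForm A B C D E F := by
  refine h.of_mulVec !![a, b, 0; c, d, 0; 0, 0, 1] ?_ fun x => ?_
  · simp [Matrix.det_fin_three]
    linarith
  · simp [Phi6, Matrix.mulVec, dotProduct, Fin.sum_univ_three]
    ring

/-- The unimodular substitution `(Y, Z) ↦ (aY + bZ, cY + dZ)`. -/
lemma HasStandardForm.of_subst_YZ {A B C D E F : ℤ} (a b c d : ℤ) (hdet : a * d - b * c = 1)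
    (h : HasStandardForm A (B * a + D * c) (C * a ^ 2 + E * a * c + F * c ^ 2)
      (B * b + D * d) (2 * C * a * b + E * (a * d + b * c) + 2 * F * c * d)
      (C * b ^ 2 + E * b * d + F * d ^ 2)) :
    HasStandardForm A B C D E F := by
  refine h.of_mulVec !![1, 0, 0; 0, a, b; 0, c, d] ?_ fun x => ?_
  · simp [Matrix.det_fin_three]
    linarith
  · simp [Phi6, Matrix.mulVec, dotProduct, Fin.sum_univ_three]
    ring

lemma hasStandardForm_of_pos {A B C D : ℤ} (hdisc : 0 < disc6 A B C D 0 0) (hD : 0 ≤ D) :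
    HasStandardForm A B C D 0 0 := by
  have h : 0 < -C * D ^ 2 := by simpa [disc6] using hdisc
  have hD0 : D ≠ 0 := by
    rintro rfl
    simp at h
  have hC : 0 < -C := pos_of_mul_pos_left h (sq_nonneg D)
  exact ⟨1, -A, -B, -C, D, by omega, by omega, fun x => by simp⟩

/-- A form of positive discriminant vanishing at `(0, 0, 1)` has a standard form. -/
lemma hasStandardForm_of_vanishing {A B C D E : ℤ} (hdisc : 0 < disc6 A B C D E 0) :
    HasStandardForm A B C D E 0 := by
  obtain ⟨g, p, q, u, v, hg, hD, hE, huv⟩ := exists_eq_mul_coprime D E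
  refine .of_subst_XY u (-q) v p (by linarith) ?_
  have hDg : D * u + E * v = g := by
    rw [hD, hE]
    linear_combination g * huv
  have hE0 : D * -q + E * p = 0 := by
    rw [hD, hE]
    ring
  rw [hDg, hE0]
  refine hasStandardForm_of_pos ?_ hg
  convert hdisc using 1
  rw [hD, hE]
  simp only [disc6]
  ring

lemma hasStandardForm_of_zero_YZ {A B C D E F y z : ℤ} (hdisc : 0 < disc6 A B C D E F)
    (h0 : y ≠ 0 ∨ z ≠ 0) (hz : C * y ^ 2 + E * y * z + F * z ^ 2 = 0) :
    HasStandardForm A B C D E F := by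
  obtain ⟨g, p, q, u, v, -, rfl, rfl, huv⟩ := exists_eq_mul_coprime y z
  have hdet : v * q - p * -u = 1 := by linarith
  have hg : g ≠ 0 := by
    rintro rfl
    simp at h0
  have hF : C * p ^ 2 + E * p * q + F * q ^ 2 = 0 := by
    apply (mul_eq_zero.mp _).resolve_left (pow_ne_zero 2 hg)
    linear_combination hz
  refine .of_subst_YZ v p (-u) q hdet ?_
  rw [hF]
  apply hasStandardForm_of_vanishing
  rw [← hF]
  have hdisc' : 0 < disc6 A B C D E F * (v * q - p * -u) ^ 2 := by
    rwa [hdet, one_pow, mul_one]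
  convert hdisc' using 1
  simp only [disc6]
  ring

lemma hasStandardForm_of_zero {A B C D E F x y z : ℤ} (hdisc : 0 < disc6 A B C D E F)
    (h0 : x ≠ 0 ∨ y ≠ 0 ∨ z ≠ 0)
    (hz : A * x ^ 2 + B * x * y + C * y ^ 2 + D * x * z + E * y * z + F * z ^ 2 = 0) :
    HasStandardForm A B C D E F := by
  obtain ⟨g, p, q, u, v, -, rfl, rfl, huv⟩ := exists_eq_mul_coprime x y
  have hdet : v * q - p * -u = 1 := by linarith
  refine .of_subst_XY v p (-u) q hdet (hasStandardForm_of_zero_YZ (y := g) (z := z) ?_ ?_ ?_)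
  · have hdisc' : 0 < disc6 A B C D E F * (v * q - p * -u) ^ 2 := by
      rwa [hdet, one_pow, mul_one]
    convert hdisc' using 1
    simp only [disc6]
    ring
  · by_contra! h
    simp [h.1, h.2] at h0
  · linear_combination hz

/-- every integral isotropic ternary quadratic form of positive discriminant
is `SL₃(ℤ)`-equivalent to one of the standard forms `-A X² - B XY - C Y² + D XZ` with
`C, D ≥ 1`. -/
theorem stmt7 (A B C D E F : ℤ) (hdisc : 0 < disc6 A B C D E F)
    (hiso : ∃ P : Fin 3 → ℤ, P ≠ 0 ∧ Phi6 A B C D E F (intCast3 P) = 0) :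
    ∃ (U : Matrix.SpecialLinearGroup (Fin 3) ℤ) (A' B' C' D' : ℤ),
      1 ≤ C' ∧ 1 ≤ D' ∧
      ∀ x : V3,
        Phi6 A B C D E F (((U : Matrix (Fin 3) (Fin 3) ℤ).map (Int.cast : ℤ → ℝ)).mulVec x) =
          Phi6 (-A') (-B') (-C') D' 0 0 x := by
  obtain ⟨P, hP, hz⟩ := hiso
  refine hasStandardForm_of_zero (x := P 0) (y := P 1) (z := P 2) hdisc ?_ ?_
  · by_contra! h
    exact hP (funext fun i => by fin_cases i <;> simp [h.1, h.2.1, h.2.2])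
  · simp only [Phi6, intCast3] at hz
    exact_mod_cast hz

end
end

section
/- Let A, B, C, D be integers. The ℤ-span R_{A,B,C,D} of the four matrices I = [[1,0],[0,1]], M₁ = [[B,C],[−A,0]], M₂ = [[0,0],[0,D]], M₃ = [[0,0],[D,0]] inside Mat₂(ℤ) is closed under matrix multiplication (hence is a subring of Mat₂(ℤ) containing the identity). Moreover, if C ≥ 1 and D ≥ 1, then R_{A,B,C,D} has finite index C·D² as an additive subgroup of Mat₂(ℤ). -/
noncomputable section

theorem mem_Rring_iff {A B C D : ℤ} {x : Matrix (Fin 2) (Fin 2) ℤ} :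
    x ∈ Rring A B C D ↔
      ∃ n m p q : ℤ, x = !![n + B * m, C * m; -A * m + D * p, n + D * q] := by
  simp only [Rring, Matrix.one_fin_two, Submodule.mem_span_insert, Submodule.mem_span_singleton]
  constructor
  · rintro ⟨n, _, ⟨m, _, ⟨q, _, ⟨p, rfl⟩, rfl⟩, rfl⟩, rfl⟩
    refine ⟨n, m, p, q, ?_⟩
    ext i j
    fin_cases i <;> fin_cases j <;> simp <;> ring
  · rintro ⟨n, m, p, q, rfl⟩
    refine ⟨n, _, ⟨m, _, ⟨q, _, ⟨p, rfl⟩, rfl⟩, rfl⟩, ?_⟩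
    ext i j
    fin_cases i <;> fin_cases j <;> simp <;> ring

theorem mul_mem_Rring {A B C D : ℤ} {x y : Matrix (Fin 2) (Fin 2) ℤ}
    (hx : x ∈ Rring A B C D) (hy : y ∈ Rring A B C D) : x * y ∈ Rring A B C D := by
  obtain ⟨n, m, p, q, rfl⟩ := mem_Rring_iff.1 hx
  obtain ⟨n', m', p', q', rfl⟩ := mem_Rring_iff.1 hy
  refine mem_Rring_iff.2
    ⟨n * n' - A * C * m * m' + C * D * m * p' - B * D * m * q',
      (n + B * m) * m' + m * (n' + D * q'),
      p * (n' + B * m') + n * p' - A * q * m' + D * q * p' + A * m * q',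
      p * C * m' + n * q' + q * n' + D * q * q' - C * m * p' + B * m * q', ?_⟩
  ext i j
  fin_cases i <;> fin_cases j <;> simp [Matrix.mul_apply, Fin.sum_univ_two] <;> ring

/-- The spanning family of `Rring A B C D`. -/
def RringGen (A B C D : ℤ) : Fin 4 → Matrix (Fin 2) (Fin 2) ℤ :=
  ![1, !![B, C; -A, 0], !![0, 0; 0, D], !![0, 0; D, 0]]

theorem span_range_RringGen (A B C D : ℤ) :
    Submodule.span ℤ (Set.range (RringGen A B C D)) = Rring A B C D := by
  rw [Rring]
  congr 1
  ext x
  simp [RringGen]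
  tauto

theorem linearIndependent_RringGen {A B C D : ℤ} (hC : C ≠ 0) (hD : D ≠ 0) :
    LinearIndependent ℤ (RringGen A B C D) := by
  rw [Fintype.linearIndependent_iff]
  intro g hg
  have h00 := congrFun (congrFun hg 0) 0
  have h01 := congrFun (congrFun hg 0) 1
  have h10 := congrFun (congrFun hg 1) 0
  have h11 := congrFun (congrFun hg 1) 1
  simp [RringGen, Fin.sum_univ_four, Matrix.one_fin_two, -zsmul_eq_mul, -Int.zsmul_eq_mul, hC] at h00 h01 h10 h11
  simp [h01] at h00 h10 h11
  simp [h00, hD] at h10 h11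
  intro i
  fin_cases i <;> assumption

/-- The matrix units as a basis of the `2 × 2` integer matrices, in lexicographic order. -/
def matrixUnitsBasis : Module.Basis (Fin 4) ℤ (Matrix (Fin 2) (Fin 2) ℤ) :=
  (Matrix.stdBasis ℤ (Fin 2) (Fin 2)).reindex finProdFinEquiv

theorem matrixUnitsBasis_repr (x : Matrix (Fin 2) (Fin 2) ℤ) (i : Fin 4) :
    matrixUnitsBasis.repr x i = ![x 0 0, x 0 1, x 1 0, x 1 1] i := by
  have h (a b : Fin 2) : (Matrix.stdBasis ℤ (Fin 2) (Fin 2)).repr x (a, b) = x a b := by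
    simp [Matrix.stdBasis]
  rw [matrixUnitsBasis, Module.Basis.repr_reindex_apply]
  fin_cases i <;> exact h _ _

theorem det_RringGen (A B C D : ℤ) :
    matrixUnitsBasis.det (RringGen A B C D) = -(C * D ^ 2) := by
  have h : matrixUnitsBasis.toMatrix (RringGen A B C D) =
      !![1, B, 0, 0; 0, C, 0, 0; 0, -A, 0, D; 1, 0, D, 0] := by
    ext i j
    rw [Module.Basis.toMatrix_apply, matrixUnitsBasis_repr]
    fin_cases i <;> fin_cases j <;> simp [RringGen]
  rw [Module.Basis.det_apply, h]
  simp [Matrix.det_succ_row_zero, Fin.sum_univ_succ, Fin.succAbove, sq]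

theorem index_Rring {A B C D : ℤ} (hC : C ≠ 0) (hD : D ≠ 0) :
    (Rring A B C D).toAddSubgroup.index = (C * D ^ 2).natAbs := by
  let b := Module.Basis.span (linearIndependent_RringGen (A := A) (B := B) hC hD)
  have h := AddSubgroup.index_eq_natAbs_det matrixUnitsBasis
    (Submodule.span ℤ (Set.range (RringGen A B C D))).toAddSubgroup b
  have hb : (fun i => (b i : Matrix (Fin 2) (Fin 2) ℤ)) = RringGen A B C D :=
    funext fun i => congrArg Subtype.val (Module.Basis.span_apply _ i)
  rw [← span_range_RringGen, h]
  change (matrixUnitsBasis.det fun i => (b i : Matrix (Fin 2) (Fin 2) ℤ)).natAbs = _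
  rw [hb, det_RringGen, Int.natAbs_neg]

/-- `R_{A,B,C,D}` contains the identity and is closed under matrix
multiplication (hence is a subring of `Mat₂(ℤ)`); if `C, D ≥ 1`, it has additive index
`C·D²` in `Mat₂(ℤ)`. -/
theorem stmt8 (A B C D : ℤ) :
    (1 : Matrix (Fin 2) (Fin 2) ℤ) ∈ Rring A B C D ∧
    (∀ x ∈ Rring A B C D, ∀ y ∈ Rring A B C D, x * y ∈ Rring A B C D) ∧
    (1 ≤ C → 1 ≤ D → (Rring A B C D).toAddSubgroup.index = (C * D ^ 2).toNat) := by
  refine ⟨Submodule.subset_span (by simp), fun x hx y hy => mul_mem_Rring hx hy,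
    fun hC hD => ?_⟩
  rw [index_Rring (by lia) (by lia)]
  have : 0 ≤ C * D ^ 2 := by positivity
  lia

end
end
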